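/- New sum rule relative to the shifted hard-edge Marchenko–Pastur law: Let 𝒟 be the measure with density (1/2π)·√((2−x)/(2+x)) on (−2,2). For every nontrivial probability measure μ on [−2,2] with canonical moments (u_k)_{k≥1} and u₀ = −1: K(𝒟 | μ) = ∑_{k=1}^∞ [ (1−u_{k−1})(1+u_k) − log((1−u_{k−1})(1+u_k)) − 1 ], where both sides may be infinite simultaneously. -/

import Mathlib

open MeasureTheory Real Filter Set Topology Polynomial
open scoped ENNReal ComplexConjugate

noncomputable section

namespace SumRules

-- Kullback–Leibler divergence `K(ν | μ)`.
open Classical in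
def KLdiv {α : Type*} [MeasurableSpace α] (ν μ : Measure α) : ℝ≥0∞ :=
  if ν ≪ μ ∧ Integrable (llr ν μ) ν then ENNReal.ofReal (∫ x, llr ν μ x ∂ν) else ⊤

/-- The (topological) support of a measure. -/
def suppSet {α : Type*} [TopologicalSpace α] [MeasurableSpace α] (μ : Measure α) : Set α :=
  {x | ∀ U ∈ nhds x, μ U ≠ 0}

/-- A measure is nontrivial if its support is infinite, i.e. it is not carried
by any finite set. -/
def InfiniteSupport {α : Type*} [MeasurableSpace α] (μ : Measure α) : Prop :=
  ∀ s : Finset α, μ (↑s : Set α)ᶜ ≠ 0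

/-- The set of support points outside `[cm, cp]`. -/
def ES (μ : Measure ℝ) (cm cp : ℝ) : Set ℝ := suppSet μ \ Icc cm cp

/-- `μ ∈ 𝒮₁(cm, cp)`: the support of `μ` is contained in `[cm, cp]` together with an
at most countable set of points outside this interval. -/
def InS1 (μ : Measure ℝ) (cm cp : ℝ) : Prop := (ES μ cm cp).Countable

/-- `a b` (indexed so that `a (k+1) = a_{k+1}`, `b (k+1) = b_{k+1}`, `k ≥ 0`) are the Jacobi
coefficients of `μ`: there is a sequence of orthonormal polynomials (with positive leading
coefficients, obtained by Gram-Schmidt from `1, x, x², …`) satisfying the three-term recursion. -/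
def IsJacobi (μ : Measure ℝ) (a b : ℕ → ℝ) : Prop :=
  (∀ k : ℕ, 0 < a (k+1)) ∧
  ∃ p : ℕ → Polynomial ℝ,
    (∀ k, (p k).natDegree = k) ∧ (∀ k, 0 < (p k).leadingCoeff) ∧
    (∀ j k, ∫ x, (p j).eval x * (p k).eval x ∂μ = if j = k then 1 else 0) ∧
    (∀ (k : ℕ) (x : ℝ), x * (p k).eval x =
      a (k+1) * (p (k+1)).eval x + b (k+1) * (p k).eval x +
        (if k = 0 then 0 else a k * (p (k-1)).eval x))

/-- `u` is the sequence of canonical moments of a measure on `[-2,2]` (with `u 0 = -1`). -/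
def IsCanonicalMoments (μ : Measure ℝ) (u : ℕ → ℝ) : Prop :=
  u 0 = -1 ∧ (∀ k : ℕ, u (k+1) ∈ Ioo (-1 : ℝ) 1) ∧
  ∃ a b : ℕ → ℝ, IsJacobi μ a b ∧
    (∀ k : ℕ, b (k+1) = (1 - u (2*k)) * u (2*k+1) - (1 + u (2*k)) * u (2*k-1)) ∧
    (∀ k : ℕ, (a (k+1))^2 = (1 - u (2*k)) * (1 - (u (2*k+1))^2) * (1 + u (2*k+2)))

/-- `z` is the sequence of canonical coefficients of a measure supported in `[0,∞)`. -/
def IsCanonicalZ (μ : Measure ℝ) (z : ℕ → ℝ) : Prop :=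
  z 0 = 0 ∧ (∀ k : ℕ, 0 ≤ z (k+1)) ∧
  ∃ a b : ℕ → ℝ, IsJacobi μ a b ∧
    (∀ k : ℕ, b (k+1) = z (2*k) + z (2*k+1)) ∧
    (∀ k : ℕ, (a (k+1))^2 = z (2*k+1) * z (2*k+2))

def Gfun (x : ℝ) : ℝ := x - 1 - Real.log x

/-- The semicircle law. -/
def SCm : Measure ℝ :=
  volume.withDensity fun x => ENNReal.ofReal (Real.sqrt (4 - x^2) / (2*π))

/-- The arcsine law on `(-2,2)`. -/
def ArcsineM : Measure ℝ :=
  volume.withDensity fun x => ENNReal.ofReal (1 / (π * Real.sqrt (4 - x^2)))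

/-- The measure with density `(2/(π|q-p|)) √((x-p)/(q-x))` between `p` and `q`. -/
def Dmeas (p q : ℝ) : Measure ℝ :=
  volume.withDensity fun x => ENNReal.ofReal (2/(π * |q - p|) * Real.sqrt ((x - p)/(q - x)))

/-- The point `e^{iθ}` on the unit circle. -/
def ctheta (θ : ℝ) : ℂ := Complex.exp (θ * Complex.I)

/-- Reversed polynomial `Φ*` with conjugated coefficients: `Φ*(z) = z^k conj(Φ(1/conj z))`. -/
def polyStar (P : Polynomial ℂ) : Polynomial ℂ := (P.map (starRingEnd ℂ)).reverse

/-- `α` is the sequence of Verblunsky coefficients of the measure `ν` on the unit circle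
(`ν` being given in angle coordinates, carried by `[0, 2π)`): the monic orthogonal
polynomials of `ν` satisfy the Szegő recursion with coefficients `α`. -/
def IsVerblunsky (ν : Measure ℝ) (α : ℕ → ℂ) : Prop :=
  (∀ k, ‖α k‖ < 1) ∧
  ∃ Φ : ℕ → Polynomial ℂ,
    (∀ k, (Φ k).Monic) ∧ (∀ k, (Φ k).natDegree = k) ∧
    (∀ j k, j ≠ k →
      ∫ θ, conj ((Φ j).eval (ctheta θ)) * (Φ k).eval (ctheta θ) ∂ν = 0) ∧
    (∀ k, Φ (k+1) = Polynomial.X * Φ k - Polynomial.C (conj (α k)) * polyStar (Φ k))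

/-- `γ` is the sequence of deformed Verblunsky coefficients of `ν`. -/
def IsDeformedVerblunsky (ν : Measure ℝ) (γ : ℕ → ℂ) : Prop :=
  ∃ α : ℕ → ℂ, IsVerblunsky ν α ∧
    ∀ k : ℕ, γ k = conj (α k) * ∏ j ∈ Finset.range k, (1 - conj (γ j)) / (1 - γ j)

/-- Symmetry of a measure on the circle (in angle coordinates): invariance under conjugation. -/
def SymmCircle (ν : Measure ℝ) : Prop :=
  (ν.map ctheta).map (starRingEnd ℂ) = ν.map ctheta

/-- The uniform measure on the circle, in angle coordinates. -/
def UNIFm : Measure ℝ :=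
  volume.withDensity fun θ => ENNReal.ofReal (if 0 ≤ θ ∧ θ < 2*π then 1/(2*π) else 0)

end SumRules

namespace SumRules

/-- Outlier contribution for the Killip–Simon sum rule (`+∞` inside `(-2,2)`). -/
def FSC (x : ℝ) : ℝ≥0∞ :=
  if 2 ≤ |x| then
    ENNReal.ofReal (|x|/2 * Real.sqrt (x^2 - 4) - 2 * Real.log ((|x| + Real.sqrt (x^2 - 4))/2))
  else ⊤

/-- Coefficient side of the Killip–Simon sum rule. -/
def IH (a b : ℕ → ℝ) : ℝ≥0∞ :=
  (1/2 : ℝ≥0∞) * ∑' k : ℕ, ENNReal.ofReal ((b (k+1))^2)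
    + ∑' k : ℕ, ENNReal.ofReal (Gfun ((a (k+1))^2))

def tauM (τ : ℝ) : ℝ := (1 - Real.sqrt τ)^2
def tauP (τ : ℝ) : ℝ := (1 + Real.sqrt τ)^2

/-- The Marchenko–Pastur law with parameter `τ`. -/
def MPm (τ : ℝ) : Measure ℝ :=
  volume.withDensity fun x =>
    ENNReal.ofReal (Real.sqrt ((x - tauM τ) * (tauP τ - x)) / (2*π*τ*x))

/-- Outlier contribution for the Marchenko–Pastur sum rule. -/
def FMP (τ : ℝ) (x : ℝ) : ℝ≥0∞ :=
  if tauP τ ≤ x then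
    ENNReal.ofReal (∫ t in (tauP τ)..x, Real.sqrt ((t - tauP τ) * (t - tauM τ)) / (τ*t))
  else if 0 < x ∧ x ≤ tauM τ then
    ENNReal.ofReal (∫ t in x..(tauM τ), Real.sqrt ((t - tauP τ) * (t - tauM τ)) / (τ*t))
  else ⊤

/-- Coefficient side of the Marchenko–Pastur sum rule. -/
def IL (τ : ℝ) (z : ℕ → ℝ) : ℝ≥0∞ :=
  ∑' k : ℕ, ENNReal.ofReal (τ⁻¹ * Gfun (z (2*k+1)) + Gfun (τ⁻¹ * z (2*k+2)))

def uPl (κ₁ κ₂ : ℝ) : ℝ :=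
  2*(κ₂^2 - κ₁^2 + 4*Real.sqrt ((1+κ₁)*(1+κ₂)*(1+κ₁+κ₂)))/(2+κ₁+κ₂)^2
def uMi (κ₁ κ₂ : ℝ) : ℝ :=
  2*(κ₂^2 - κ₁^2 - 4*Real.sqrt ((1+κ₁)*(1+κ₂)*(1+κ₁+κ₂)))/(2+κ₁+κ₂)^2

/-- The Kesten–McKay law with parameters `κ₁, κ₂`. -/
def KMKm (κ₁ κ₂ : ℝ) : Measure ℝ :=
  volume.withDensity fun x =>
    ENNReal.ofReal ((2+κ₁+κ₂)/(2*π) * Real.sqrt ((x - uMi κ₁ κ₂) * (uPl κ₁ κ₂ - x)) / (4 - x^2))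

def ue (κ₁ κ₂ : ℝ) : ℝ := -(κ₁+κ₂)/(2+κ₁+κ₂)
def uo (κ₁ κ₂ : ℝ) : ℝ := (κ₂-κ₁)/(2+κ₁+κ₂)

def He (κ₁ κ₂ u : ℝ) : ℝ :=
  -(1+κ₁+κ₂) * Real.log ((1-u)/(1 - ue κ₁ κ₂)) - Real.log ((1+u)/(1 + ue κ₁ κ₂))
def Ho (κ₁ κ₂ u : ℝ) : ℝ :=
  -(1+κ₁) * Real.log ((1-u)/(1 - uo κ₁ κ₂)) - (1+κ₂) * Real.log ((1+u)/(1 + uo κ₁ κ₂))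

/-- Coefficient side of the Kesten–McKay sum rule. -/
def IJ (κ₁ κ₂ : ℝ) (u : ℕ → ℝ) : ℝ≥0∞ :=
  ∑' k : ℕ, (ENNReal.ofReal (Ho κ₁ κ₂ (u (2*k+1))) + ENNReal.ofReal (He κ₁ κ₂ (u (2*k+2))))

/-- Outlier contribution for the Kesten–McKay sum rule. -/
def FKMK (κ₁ κ₂ : ℝ) (x : ℝ) : ℝ≥0∞ :=
  if uPl κ₁ κ₂ ≤ x then
    ENNReal.ofReal (∫ t in (uPl κ₁ κ₂)..x,
      (2+κ₁+κ₂) * Real.sqrt ((t - uPl κ₁ κ₂) * (t - uMi κ₁ κ₂)) / (4 - t^2))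
  else if x ≤ uMi κ₁ κ₂ then
    ENNReal.ofReal (∫ t in x..(uMi κ₁ κ₂),
      (2+κ₁+κ₂) * Real.sqrt ((t - uPl κ₁ κ₂) * (t - uMi κ₁ κ₂)) / (4 - t^2))
  else ⊤

def Hgw (g : ℝ) : ℝ := 1 - Real.sqrt (1 - g^2) + Real.log ((1 + Real.sqrt (1 - g^2))/2)

def thetaG (g : ℝ) : ℝ := 2 * Real.arcsin (Real.sqrt (1/|g|))

/-- The Gross–Witten measures, in angle coordinates. -/
def GWm (g : ℝ) : Measure ℝ :=
  if |g| ≤ 1 then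
    volume.withDensity fun θ =>
      ENNReal.ofReal (if 0 ≤ θ ∧ θ < 2*π then (1 + g * Real.cos θ)/(2*π) else 0)
  else if g < -1 then
    volume.withDensity fun θ => ENNReal.ofReal (
      if π - thetaG g ≤ θ ∧ θ ≤ π + thetaG g then
        |g| / π * Real.sin (θ/2) * Real.sqrt (Real.sin (θ/2)^2 - Real.cos (thetaG g/2)^2)
      else 0)
  else
    volume.withDensity fun θ => ENNReal.ofReal (
      if -thetaG g ≤ θ ∧ θ ≤ thetaG g then
        g/π * Real.cos (θ/2) * Real.sqrt (Real.sin (thetaG g/2)^2 - Real.sin (θ/2)^2)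
      else 0)

def thetaD (d : ℝ) : ℝ := 2 * Real.arcsin (d/(1+d))
def gammaD (d : ℝ) : ℝ := -d/(1+d)

/-- The Hua–Pickrell measure, in angle coordinates. -/
def HPm (d : ℝ) : Measure ℝ :=
  volume.withDensity fun θ => ENNReal.ofReal (
    if thetaD d < θ ∧ θ < 2*π - thetaD d then
      (1+d) * Real.sqrt (Real.sin (θ/2)^2 - Real.sin (thetaD d/2)^2) / (2*π*Real.sin (θ/2))
    else 0)

/-- The entropy-like function appearing in the Hua–Pickrell sum rule. -/
def HHP (d : ℝ) (γ : ℂ) : ℝ :=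
  -Real.log ((1 - ‖γ‖^2)/(1 - (gammaD d)^2)) - 2*d*Real.log (‖1 - γ‖/(1 - gammaD d))

/-- Outlier contribution for the Hua–Pickrell sum rule (in angle coordinates). -/
def FHP (d : ℝ) (θ : ℝ) : ℝ≥0∞ :=
  if θ ≤ thetaD d then
    ENNReal.ofReal (∫ φ in θ..(thetaD d),
      (1+d) * Real.sqrt (Real.sin (thetaD d/2)^2 - Real.sin (φ/2)^2) / Real.sin (φ/2))
  else if 2*π - thetaD d ≤ θ then
    ENNReal.ofReal (∫ φ in (2*π - thetaD d)..θ,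
      (1+d) * Real.sqrt (Real.sin (thetaD d/2)^2 - Real.sin (φ/2)^2) / Real.sin (φ/2))
  else ⊤

/-- Set of outlying support points for a measure on the circle, in angle coordinates. -/
def EST (ν : Measure ℝ) (tm tp : ℝ) : Set ℝ := suppSet ν \ Icc tm tp

/-- `ν ∈ 𝒮₁^𝕋(tm, tp)` (in angle coordinates). -/
def InS1T (ν : Measure ℝ) (tm tp : ℝ) : Prop := (EST ν tm tp).Countable

/-- The measure `𝒟(2,-2)`, with density `(1/2π)√((2-x)/(2+x))` on `(-2,2)`
(a shift of the hard-edge Marchenko–Pastur law). -/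
def Dhard : Measure ℝ :=
  volume.withDensity fun x => ENNReal.ofReal (Real.sqrt ((2 - x)/(2 + x)) / (2*π))

/-- The mixture `μ_g = |g| 𝒟(2,-2) + (1-|g|) Arcsine`. -/
def mugMix (g : ℝ) : Measure ℝ :=
  ENNReal.ofReal |g| • Dhard + ENNReal.ofReal (1 - |g|) • ArcsineM

/-- The mixture `ρ_g = |g| SC + (1-|g|) Arcsine`. -/
def rhog (g : ℝ) : Measure ℝ :=
  ENNReal.ofReal |g| • SCm + ENNReal.ofReal (1 - |g|) • ArcsineM

def Cg (g : ℝ) : ℝ :=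
  -|g| * (1 - Real.log 2) + 1 - Real.sqrt (1 - g^2) + Real.log ((1 + Real.sqrt (1 - g^2))/2)

/-- The measure with density `(1/2π)(2+x)^{3/2}(2-x)^{1/2}` on `[-2,2]`. -/
def muHat : Measure ℝ :=
  volume.withDensity fun x =>
    ENNReal.ofReal ((2 + x) * Real.sqrt (2 + x) * Real.sqrt (2 - x) / (2*π))

/-- The Poisson kernel measure `Pois(ζ)`, in angle coordinates. -/
def PoisM (ζ : ℂ) : Measure ℝ :=
  volume.withDensity fun θ => ENNReal.ofReal (
    if 0 ≤ θ ∧ θ < 2*π then (1 - ‖ζ‖^2)/(2*π*‖ctheta θ - ζ‖^2) else 0)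

/-- The Carathéodory function of a measure on the circle (angle coordinates). -/
def Cara (ν : Measure ℝ) (z : ℂ) : ℂ := ∫ θ, (ctheta θ + z)/(ctheta θ - z) ∂ν

/-- `f` is the Schur function of `ν`. -/
def IsSchurFn (ν : Measure ℝ) (f : ℂ → ℂ) : Prop :=
  DifferentiableOn ℂ f (Metric.ball 0 1) ∧
  (∀ z ∈ Metric.ball (0:ℂ) 1, ‖f z‖ ≤ 1) ∧
  (∀ z ∈ Metric.ball (0:ℂ) 1, Cara ν z - 1 = z * f z * (Cara ν z + 1))

/-- Möbius transform of the unit disk. -/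
def mtrans (ρ z : ℂ) : ℂ := (z - ρ)/(1 - conj ρ * z)

def npRaw (ρ : ℂ) (g : ℂ → ℂ) (z : ℂ) : ℂ :=
  ((-ρ/(‖ρ‖ : ℂ)) / mtrans ρ z) * ((g z - g ρ)/(1 - conj (g ρ) * g z))

-- One step of the Nevanlinna–Pick algorithm at `ρ` (the removable singularity at `ρ`
-- is filled in by the limit).
open Classical in
def npStep (ρ : ℂ) (g : ℂ → ℂ) : ℂ → ℂ := fun z =>
  if z = ρ then limUnder (𝓝[≠] ρ) (npRaw ρ g) else npRaw ρ g z

def schurRaw (g : ℂ → ℂ) (z : ℂ) : ℂ := ((g z - g 0)/z)/(1 - conj (g 0) * g z)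

-- One step of the classical Schur algorithm (the removable singularity at `0`
-- is filled in by the limit).
open Classical in
def schurStep (g : ℂ → ℂ) : ℂ → ℂ := fun z =>
  if z = 0 then limUnder (𝓝[≠] (0:ℂ)) (schurRaw g) else schurRaw g z

def xdHP (d : ℝ) : ℝ := 2*(1 + 2*d - d^2)/(1+d)^2

def uKMK (d : ℝ) : ℝ := 2*Real.sqrt (1 + 2*d)/(1+d)

end SumRules

namespace SumRules

lemma kl_pt (r f : ℝ) (hr : 0 ≤ r) :
    r * f + 1 - Real.exp f ≤ InformationTheory.klFun r := by
  rw [InformationTheory.klFun_apply]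
  rcases hr.eq_or_lt with rfl | hr
  · simp; exact (Real.exp_pos f).le
  · have h1 := Real.add_one_le_exp (f - Real.log r)
    rw [Real.exp_sub, Real.exp_log hr, le_div_iff₀ hr] at h1
    nlinarith

lemma kl_dual_lower (D μ : Measure ℝ) [IsProbabilityMeasure D] [IsProbabilityMeasure μ]
    (h : InformationTheory.klDiv D μ ≠ ⊤) (f : ℝ → ℝ) (hf : Measurable f) (M : ℝ)
    (hM : ∀ x, |f x| ≤ M) :
    ∫ x, f x ∂D + 1 - ∫ x, Real.exp (f x) ∂μ ≤ (InformationTheory.klDiv D μ).toReal := by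
  obtain ⟨hac, hint⟩ := InformationTheory.klDiv_ne_top_iff.1 h
  rw [InformationTheory.toReal_klDiv_eq_integral_klFun hac, ← integral_rnDeriv_smul hac]
  have hfD : Integrable f D :=
    Integrable.of_bound hf.aestronglyMeasurable M (Eventually.of_forall hM)
  have i1 : Integrable (fun x => (D.rnDeriv μ x).toReal • f x) μ :=
    (integrable_rnDeriv_smul_iff hac).2 hfD
  have i2 : Integrable (fun x => Real.exp (f x)) μ := by
    refine Integrable.of_bound (Real.measurable_exp.comp hf).aestronglyMeasurable (Real.exp M)
      (Eventually.of_forall fun x => ?_)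
    rw [Real.norm_eq_abs, Real.abs_exp]
    exact Real.exp_le_exp.2 ((le_abs_self _).trans (hM x))
  have i3 := (InformationTheory.integrable_klFun_rnDeriv_iff hac).2 hint
  have e1 : ∫ x, (D.rnDeriv μ x).toReal • f x ∂μ + 1 - ∫ x, Real.exp (f x) ∂μ
      = ∫ x, ((D.rnDeriv μ x).toReal • f x + 1 - Real.exp (f x)) ∂μ := by
    have := integral_sub (i1.add (integrable_const (1:ℝ))) i2
    have h2 := integral_add i1 (integrable_const (1:ℝ))
    simp only [Pi.add_apply] at this h2
    rw [h2] at this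
    simpa using this.symm
  rw [e1]
  refine integral_mono ((i1.add (integrable_const _)).sub i2) i3 fun x => ?_
  exact kl_pt _ _ ENNReal.toReal_nonneg

lemma dual_ext (D μ : Measure ℝ) [IsProbabilityMeasure D] [IsProbabilityMeasure μ] (C : ℝ)
    (H : ∀ f : ℝ → ℝ, Continuous f → (∃ M, ∀ x, |f x| ≤ M) →
      ∫ x, f x ∂D + 1 - ∫ x, Real.exp (f x) ∂μ ≤ C)
    (f : ℝ → ℝ) (hf : Measurable f) (M : ℝ) (hM : ∀ x, |f x| ≤ M) :
    ∫ x, f x ∂D + 1 - ∫ x, Real.exp (f x) ∂μ ≤ C := by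
  have hfν : MemLp f 1 (D + μ) :=
    MemLp.of_bound hf.aestronglyMeasurable M (Eventually.of_forall hM)
  have hex : ∀ n : ℕ, ∃ g : BoundedContinuousFunction ℝ ℝ,
      eLpNorm (f - ⇑g) 1 (D + μ) ≤ ENNReal.ofReal (1 / (n + 1)) ∧ MemLp (⇑g) 1 (D + μ) := fun n =>
    hfν.exists_boundedContinuous_eLpNorm_sub_le (by simp)
      (by simp only [ne_eq, ENNReal.ofReal_eq_zero, not_le]; positivity)
  choose g hg hgm using hex
  have ht : Tendsto (fun n => eLpNorm (⇑(g n) - f) 1 (D + μ)) atTop (𝓝 0) := by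
    have h0 : Tendsto (fun n : ℕ => ENNReal.ofReal (1 / ((n : ℝ) + 1))) atTop (𝓝 0) := by
      simpa using ENNReal.tendsto_ofReal (tendsto_one_div_add_atTop_nhds_zero_nat (𝕜 := ℝ))
    refine tendsto_of_tendsto_of_tendsto_of_le_of_le tendsto_const_nhds h0 (fun _ => zero_le)
      fun n => ?_
    show eLpNorm (⇑(g n) - f) 1 (D + μ) ≤ _
    rw [eLpNorm_sub_comm]; exact hg n
  have hm := tendstoInMeasure_of_tendsto_eLpNorm (p := 1) (by simp)
    (fun n => (hgm n).aestronglyMeasurable) hf.aestronglyMeasurable ht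
  obtain ⟨ns, -, hns⟩ := hm.exists_seq_tendsto_ae
  set h : ℕ → ℝ → ℝ := fun n x => max (-M) (min M (g (ns n) x)) with hh
  have hM0 : 0 ≤ M := (abs_nonneg _).trans (hM 0)
  have hhc : ∀ n, Continuous (h n) := fun n => by
    have := (g (ns n)).continuous
    simp only [hh]; fun_prop
  have hhb : ∀ n x, |h n x| ≤ M := fun n x => by
    simp only [hh, abs_le]
    exact ⟨le_max_left _ _, max_le (by linarith) (min_le_left _ _)⟩
  have hlim : ∀ᵐ x ∂(D + μ), Tendsto (fun n => h n x) atTop (𝓝 (f x)) := by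
    filter_upwards [hns] with x hx
    have h1 : max (-M) (min M (f x)) = f x := by
      rw [min_eq_right ((le_abs_self _).trans (hM x)), max_eq_right (abs_le.1 (hM x)).1]
    rw [← h1]
    exact tendsto_const_nhds.max (tendsto_const_nhds.min hx)
  have hlim' := hlim
  rw [ae_add_measure_iff] at hlim
  have l1 : Tendsto (fun n => ∫ x, h n x ∂D) atTop (𝓝 (∫ x, f x ∂D)) := by
    refine tendsto_integral_of_dominated_convergence (fun _ => M)
      (fun n => (hhc n).aestronglyMeasurable) (integrable_const _)
      (fun n => Eventually.of_forall (hhb n)) hlim.1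
  have l2 : Tendsto (fun n => ∫ x, Real.exp (h n x) ∂μ) atTop (𝓝 (∫ x, Real.exp (f x) ∂μ)) := by
    refine tendsto_integral_of_dominated_convergence (fun _ => Real.exp M)
      (fun n => (Real.continuous_exp.comp (hhc n)).aestronglyMeasurable) (integrable_const _)
      (fun n => Eventually.of_forall fun x => ?_) ?_
    · rw [Real.norm_eq_abs, Real.abs_exp]
      exact Real.exp_le_exp.2 ((le_abs_self _).trans (hhb n x))
    · filter_upwards [hlim.2] with x hx
      exact (Real.continuous_exp.tendsto _).comp hx
  exact le_of_tendsto ((l1.add_const 1).sub l2)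
    (Eventually.of_forall fun n => H _ (hhc n) ⟨M, hhb n⟩)

lemma kl_dual_upper (D μ : Measure ℝ) [IsProbabilityMeasure D] [IsProbabilityMeasure μ] (C : ℝ)
    (H : ∀ f : ℝ → ℝ, Continuous f → (∃ M, ∀ x, |f x| ≤ M) →
      ∫ x, f x ∂D + 1 - ∫ x, Real.exp (f x) ∂μ ≤ C) :
    InformationTheory.klDiv D μ ≤ ENNReal.ofReal C := by
  have H' := dual_ext D μ C H
  have hac : D ≪ μ := by
    refine Measure.AbsolutelyContinuous.mk fun A hA hμA => ?_
    by_contra hDA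
    have hpos : 0 < D.real A := by
      rw [Measure.real]; exact ENNReal.toReal_pos hDA (measure_ne_top _ _)
    obtain ⟨n, hn⟩ := exists_nat_gt (C / D.real A)
    rw [div_lt_iff₀ hpos] at hn
    have := H' (A.indicator fun _ => (n : ℝ)) (measurable_const.indicator hA) n (fun x => by
      by_cases hx : x ∈ A <;> simp [hx])
    rw [integral_indicator hA, setIntegral_const] at this
    have e : ∫ x, Real.exp (A.indicator (fun _ => (n : ℝ)) x) ∂μ = 1 := by
      have : (fun x => Real.exp (A.indicator (fun _ => (n : ℝ)) x)) =ᵐ[μ] fun _ => 1 := by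
        have : ∀ᵐ x ∂μ, x ∉ A := measure_eq_zero_iff_ae_notMem.1 hμA
        filter_upwards [this] with x hx
        simp [hx]
      rw [integral_congr_ae this]; simp
    rw [e] at this
    simp only [smul_eq_mul] at this
    nlinarith
  rw [InformationTheory.klDiv_eq_lintegral_klFun_of_ac hac]
  set r : ℝ → ℝ := fun x => (D.rnDeriv μ x).toReal with hr
  have hrm : Measurable r := (Measure.measurable_rnDeriv _ _).ennreal_toReal
  have hr0 : ∀ x, 0 ≤ r x := fun x => ENNReal.toReal_nonneg
  set F : ℕ → ℝ → ℝ := fun n x =>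
    Real.log (max (Real.exp (-n)) (min (Real.exp n) (r x))) with hF
  have hFm : ∀ n, Measurable (F n) := fun n => by simp only [hF]; fun_prop
  have hFb : ∀ n x, |F n x| ≤ n := fun n x => by
    have hp : 0 < max (Real.exp (-n)) (min (Real.exp n) (r x)) :=
      lt_max_of_lt_left (Real.exp_pos _)
    simp only [hF, abs_le]
    constructor
    · rw [Real.le_log_iff_exp_le hp]; exact le_max_left _ _
    · rw [Real.log_le_iff_le_exp hp]
      refine max_le (Real.exp_le_exp.2 ?_) (min_le_left _ _)
      have : (0 : ℝ) ≤ n := Nat.cast_nonneg n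
      linarith
  have hFe : ∀ n x, Real.exp (F n x) = max (Real.exp (-n)) (min (Real.exp n) (r x)) := fun n x =>
    Real.exp_log (lt_max_of_lt_left (Real.exp_pos _))
  set G : ℕ → ℝ → ℝ := fun n x => r x * F n x + 1 - Real.exp (F n x) with hG
  have hGnn : ∀ n x, 0 ≤ G n x := fun n x => by
    simp only [hG]
    have hn : (0 : ℝ) ≤ n := Nat.cast_nonneg n
    have key := Real.add_one_le_exp (-(F n x))
    have hk : (1 - F n x) * Real.exp (F n x) ≤ 1 := by
      have := mul_le_mul_of_nonneg_right key (Real.exp_pos (F n x)).le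
      rw [← Real.exp_add] at this; simp at this; linarith
    -- the values: exp F lies between 1 and r
    have hk2 : 0 ≤ (r x - Real.exp (F n x)) * F n x := by
      rw [hFe]
      have e1 : Real.exp (-n) ≤ 1 := Real.exp_le_one_iff.2 (by linarith)
      have e2 : 1 ≤ Real.exp n := Real.one_le_exp hn
      rcases le_total (r x) 1 with h1 | h1
      · have : F n x ≤ 0 := by
          simp only [hF]
          refine Real.log_nonpos (le_max_of_le_left (Real.exp_pos _).le) (max_le e1 ?_)
          exact (min_le_right _ _).trans h1
        refine mul_nonneg_of_nonpos_of_nonpos ?_ this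
        rw [min_eq_right (h1.trans e2)]
        linarith [le_max_right (Real.exp (-n)) (r x)]
      · have : 0 ≤ F n x := by
          simp only [hF]
          refine Real.log_nonneg (le_max_of_le_right (le_min e2 h1))
        refine mul_nonneg ?_ this
        rw [sub_nonneg]
        exact max_le (e1.trans h1) (min_le_right _ _)
    nlinarith
  have hFl : ∀ x, Tendsto (fun n => Real.exp (F n x)) atTop (𝓝 (r x)) := fun x => by
    simp only [hFe]
    have t1 : Tendsto (fun n : ℕ => Real.exp (-(n:ℝ))) atTop (𝓝 0) :=
      Real.tendsto_exp_neg_atTop_nhds_zero.comp tendsto_natCast_atTop_atTop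
    have t2 : Tendsto (fun n : ℕ => min (Real.exp n) (r x)) atTop (𝓝 (r x)) := by
      have : ∀ᶠ n : ℕ in atTop, r x ≤ Real.exp n :=
        (Real.tendsto_exp_atTop.comp tendsto_natCast_atTop_atTop).eventually_ge_atTop _
      refine tendsto_const_nhds.congr' ?_
      filter_upwards [this] with n hn
      rw [min_eq_right hn]
    have := t1.max t2
    rwa [max_eq_right (hr0 x)] at this
  have hGl : ∀ x, Tendsto (fun n => G n x) atTop (𝓝 (InformationTheory.klFun (r x))) := fun x => by
    rw [InformationTheory.klFun_apply]
    refine Tendsto.sub (Tendsto.add_const _ ?_) (hFl x)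
    rcases (hr0 x).eq_or_lt with h0 | h0
    · rw [← h0]; simp
    · refine Tendsto.const_mul _ ?_
      have := (Real.continuousAt_log h0.ne').tendsto.comp (hFl x)
      refine this.congr fun n => ?_
      simp
  have hGm : ∀ n, Measurable (G n) := fun n => by
    have := hFm n
    simp only [hG]; fun_prop
  have fatou := lintegral_liminf_le (μ := μ) (u := (atTop : Filter ℕ)) (f := fun n x => ENNReal.ofReal (G n x))
    (fun n => (hGm n).ennreal_ofReal)
  have hpt : ∀ x, liminf (fun n => ENNReal.ofReal (G n x)) atTop
      = ENNReal.ofReal (InformationTheory.klFun (r x)) := fun x =>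
    (ENNReal.tendsto_ofReal (hGl x)).liminf_eq
  simp only [hpt] at fatou
  refine fatou.trans ?_
  refine liminf_le_of_le (by isBoundedDefault) fun b hb => ?_
  obtain ⟨n, hn⟩ := hb.exists
  refine hn.trans ?_
  have hfD : Integrable (F n) D :=
    Integrable.of_bound (hFm n).aestronglyMeasurable n (Eventually.of_forall (hFb n))
  have i1 : Integrable (fun x => (D.rnDeriv μ x).toReal • F n x) μ :=
    (integrable_rnDeriv_smul_iff hac).2 hfD
  have i2 : Integrable (fun x => Real.exp (F n x)) μ := by
    refine Integrable.of_bound (Real.measurable_exp.comp (hFm n)).aestronglyMeasurable (Real.exp n)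
      (Eventually.of_forall fun x => ?_)
    rw [Real.norm_eq_abs, Real.abs_exp]
    exact Real.exp_le_exp.2 ((le_abs_self _).trans (hFb n x))
  have i4 : Integrable (G n) μ := (i1.add (integrable_const 1)).sub i2
  rw [← ofReal_integral_eq_lintegral_ofReal i4 (Eventually.of_forall (hGnn n))]
  refine ENNReal.ofReal_le_ofReal ?_
  refine le_trans (le_of_eq ?_) (H' (F n) (hFm n) n (hFb n))
  rw [← integral_rnDeriv_smul hac]
  have := integral_sub (i1.add (integrable_const (1:ℝ))) i2
  have h2 := integral_add i1 (integrable_const (1:ℝ))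
  simp only [Pi.add_apply] at this h2
  rw [h2] at this
  simpa [hG, hr] using this

lemma KLdiv_eq (D μ : Measure ℝ) [IsProbabilityMeasure D] [IsProbabilityMeasure μ] :
    KLdiv D μ = InformationTheory.klDiv D μ := by
  unfold KLdiv
  split_ifs with h
  · rw [InformationTheory.klDiv_of_ac_of_integrable h.1 h.2]; simp
  · by_contra hne
    exact h (InformationTheory.klDiv_ne_top_iff.1 (Ne.symm hne))

/-- Average over `[0, 2π]`. -/
def av {E : Type*} [NormedAddCommGroup E] [NormedSpace ℝ E] (f : ℝ → E) : E :=
  (2 * π)⁻¹ • ∫ θ in (0:ℝ)..2 * π, f θ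

section avl
variable {E : Type*} [NormedAddCommGroup E] [NormedSpace ℝ E]

lemma av_add {f g : ℝ → E} (hf : Continuous f) (hg : Continuous g) :
    av (fun θ => f θ + g θ) = av f + av g := by
  unfold av
  rw [intervalIntegral.integral_add (hf.intervalIntegrable _ _) (hg.intervalIntegrable _ _),
    smul_add]

lemma av_sub {f g : ℝ → E} (hf : Continuous f) (hg : Continuous g) :
    av (fun θ => f θ - g θ) = av f - av g := by
  unfold av
  rw [intervalIntegral.integral_sub (hf.intervalIntegrable _ _) (hg.intervalIntegrable _ _),
    smul_sub]

lemma av_const [CompleteSpace E] (c : E) : av (fun _ => c) = c := by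
  unfold av
  rw [intervalIntegral.integral_const, smul_smul, sub_zero, inv_mul_cancel₀ (by positivity),
    one_smul]

lemma av_mul_left {𝕜 : Type*} [RCLike 𝕜] (c : 𝕜) (f : ℝ → 𝕜) :
    av (fun θ => c * f θ) = c * av f := by
  unfold av
  rw [intervalIntegral.integral_const_mul, mul_smul_comm]

lemma av_sum {ι : Type*} (s : Finset ι) {f : ι → ℝ → E} (hf : ∀ i ∈ s, Continuous (f i)) :
    av (fun θ => ∑ i ∈ s, f i θ) = ∑ i ∈ s, av (f i) := by
  unfold av
  rw [intervalIntegral.integral_finsetSum fun i hi => (hf i hi).intervalIntegrable _ _,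
    Finset.smul_sum]

lemma av_mono {f g : ℝ → ℝ} (hf : Continuous f) (hg : Continuous g) (h : ∀ θ, f θ ≤ g θ) :
    av f ≤ av g := by
  unfold av
  simp only [smul_eq_mul]
  refine mul_le_mul_of_nonneg_left ?_ (by positivity)
  exact intervalIntegral.integral_mono (by positivity) (hf.intervalIntegrable _ _)
    (hg.intervalIntegrable _ _) h

lemma av_clm {F : Type*} [NormedAddCommGroup F] [NormedSpace ℝ F] [CompleteSpace E]
    [CompleteSpace F] (L : E →L[ℝ] F)
    {f : ℝ → E} (hf : Continuous f) : av (fun θ => L (f θ)) = L (av f) := by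
  unfold av
  rw [map_smul, ContinuousLinearMap.intervalIntegral_comp_comm _ (hf.intervalIntegrable _ _)]

lemma av_re {f : ℝ → ℂ} (hf : Continuous f) : av (fun θ => (f θ).re) = (av f).re :=
  av_clm Complex.reCLM hf

lemma av_conj {f : ℝ → ℂ} (hf : Continuous f) :
    av (fun θ => conj (f θ)) = conj (av f) :=
  av_clm (Complex.conjCLE : ℂ →L[ℝ] ℂ) hf

lemma av_ofReal {f : ℝ → ℝ} (hf : Continuous f) :
    av (fun θ => (f θ : ℂ)) = (av f : ℝ) :=
  av_clm Complex.ofRealCLM hf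
end avl

lemma av_half (f : ℝ → ℝ) (hf : Continuous f) (h : ∀ θ, f (2 * π - θ) = f θ) :
    av f = π⁻¹ * ∫ θ in (0:ℝ)..π, f θ := by
  unfold av
  have h1 : ∫ θ in π..2 * π, f θ = ∫ θ in (0:ℝ)..π, f θ := by
    have := intervalIntegral.integral_comp_sub_left (a := 0) (b := π) f (2 * π)
    simp only [h] at this
    rw [this]; congr 1 <;> ring
  rw [← intervalIntegral.integral_add_adjacent_intervals (hf.intervalIntegrable 0 π)
    (hf.intervalIntegrable π (2 * π)), h1, smul_eq_mul]
  have := Real.pi_pos.ne'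
  field_simp; ring

lemma image_cos : (fun θ : ℝ => 2 * Real.cos θ) '' Ioo 0 π = Ioo (-2) 2 := by
  ext x
  constructor
  · rintro ⟨θ, hθ, rfl⟩
    have h1 := Real.cos_lt_cos_of_nonneg_of_le_pi le_rfl hθ.2.le hθ.1
    have h2 := Real.cos_lt_cos_of_nonneg_of_le_pi hθ.1.le le_rfl hθ.2
    rw [Real.cos_zero] at h1
    rw [Real.cos_pi] at h2
    constructor <;> simp <;> linarith
  · rintro ⟨h1, h2⟩
    refine ⟨Real.arccos (x / 2), ⟨Real.arccos_pos.2 (by linarith), ?_⟩, ?_⟩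
    · exact lt_of_le_of_ne (Real.arccos_le_pi _) fun h => by
        rw [Real.arccos_eq_pi] at h; linarith
    · simp only
      rw [Real.cos_arccos (by linarith) (by linarith)]; ring

lemma Dhard_integral (f : ℝ → ℝ) (hf : Continuous f) :
    ∫ x, f x ∂Dhard = av (fun θ => f (2 * Real.cos θ) * (1 - Real.cos θ)) := by
  have hcont : Continuous (fun θ => f (2 * Real.cos θ) * (1 - Real.cos θ)) := by fun_prop
  rw [av_half _ hcont (fun θ => by rw [Real.cos_two_pi_sub])]
  unfold Dhard
  rw [integral_withDensity_eq_integral_toReal_smul (by fun_prop) (by simp)]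
  have h0 : ∀ x : ℝ, 0 ≤ Real.sqrt ((2 - x) / (2 + x)) / (2 * π) := fun x => by positivity
  simp only [ENNReal.toReal_ofReal (h0 _), smul_eq_mul]
  rw [← setIntegral_eq_integral_of_forall_compl_eq_zero (s := Ioo (-2) 2), ← image_cos,
    integral_image_eq_integral_abs_deriv_smul (f' := fun θ => 2 * (-Real.sin θ)) measurableSet_Ioo,
    intervalIntegral.integral_of_le Real.pi_pos.le, integral_Ioc_eq_integral_Ioo,
    ← integral_const_mul]
  · refine setIntegral_congr_fun measurableSet_Ioo fun θ hθ => ?_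
    have hs := Real.sin_pos_of_pos_of_lt_pi hθ.1 hθ.2
    have hsc := Real.sin_sq_add_cos_sq θ
    have hc1 : 0 < 1 + Real.cos θ := by nlinarith [Real.neg_one_le_cos θ, Real.cos_le_one θ]
    have hc2 : 0 < 1 - Real.cos θ := by nlinarith [Real.neg_one_le_cos θ, Real.cos_le_one θ]
    have hsq : Real.sqrt ((2 - 2 * Real.cos θ) / (2 + 2 * Real.cos θ))
        = (1 - Real.cos θ) / Real.sin θ := by
      rw [Real.sqrt_eq_iff_mul_self_eq (by apply div_nonneg <;> linarith) (by positivity)]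
      have : 2 + 2 * Real.cos θ ≠ 0 := by linarith
      field_simp
      nlinarith
    simp only [smul_eq_mul]
    rw [hsq, abs_of_neg (by linarith)]
    have := Real.pi_pos.ne'
    field_simp
  · intro θ _
    exact ((Real.hasDerivAt_cos θ).const_mul 2).hasDerivWithinAt
  · intro a ha b hb hab
    have : Real.cos a = Real.cos b := by simpa using hab
    exact Real.injOn_cos ⟨ha.1.le, ha.2.le⟩ ⟨hb.1.le, hb.2.le⟩ this
  · intro x hx
    have : (2 - x) / (2 + x) ≤ 0 := by
      simp only [mem_Ioo, not_and, not_lt] at hx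
      rcases le_or_gt x (-2) with h | h
      · exact div_nonpos_of_nonneg_of_nonpos (by linarith) (by linarith)
      · exact div_nonpos_of_nonpos_of_nonneg (by linarith [hx h]) (by linarith)
    rw [Real.sqrt_eq_zero_of_nonpos this]; simp

lemma av_cos : av (fun θ => Real.cos θ) = 0 := by
  unfold av
  rw [integral_cos]; simp

lemma av_one_sub_cos : av (fun θ => 1 - Real.cos θ) = 1 := by
  rw [av_sub continuous_const Real.continuous_cos, av_const, av_cos, sub_zero]

instance Dhard_prob : IsProbabilityMeasure Dhard := by
  have h := Dhard_integral (fun _ => 1) continuous_const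
  simp only [one_mul, av_one_sub_cos, integral_const, smul_eq_mul, mul_one] at h
  constructor
  rw [Measure.real, ENNReal.toReal_eq_one_iff] at h
  exact h

lemma int_sin_sq_log : ∫ t in (0:ℝ)..π, Real.sin t ^ 2 * Real.log (Real.sin t)
    = π / 4 - π / 2 * Real.log 2 := by
  have hcl : Continuous fun t : ℝ => Real.sin t * Real.log (Real.sin t) :=
    Real.continuous_mul_log.comp Real.continuous_sin
  have i1 : IntervalIntegrable (fun t => Real.log (Real.sin t)) volume 0 π :=
    intervalIntegrable_log_sin
  have c2 : Continuous fun t : ℝ => 2 * (Real.sin t ^ 2 * Real.log (Real.sin t)) := by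
    have : (fun t : ℝ => 2 * (Real.sin t ^ 2 * Real.log (Real.sin t)))
      = fun t => 2 * (Real.sin t * (Real.sin t * Real.log (Real.sin t))) := by
        ext t; ring
    rw [this]; fun_prop
  have c3 : Continuous fun t : ℝ => Real.cos t ^ 2 := by fun_prop
  have ftc := intervalIntegral.integral_eq_sub_of_hasDerivAt_of_le (a := 0) (b := π)
    Real.pi_pos.le (f := fun t => Real.cos t * (Real.sin t * Real.log (Real.sin t)))
    (f' := fun t => Real.log (Real.sin t) - 2 * (Real.sin t ^ 2 * Real.log (Real.sin t))
      + Real.cos t ^ 2)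
    (by fun_prop) (fun t ht => by
      have hs := Real.sin_pos_of_pos_of_lt_pi ht.1 ht.2
      have h1 := (Real.hasDerivAt_cos t).mul
        ((Real.hasDerivAt_sin t).mul ((Real.hasDerivAt_sin t).log hs.ne'))
      refine h1.congr_deriv ?_
      have := Real.sin_sq_add_cos_sq t
      simp only [Pi.mul_apply]
      field_simp
      have e : Real.cos t ^ 2 = 1 - Real.sin t ^ 2 := by linarith
      rw [e]; ring)
    ((i1.sub (c2.intervalIntegrable _ _)).add (c3.intervalIntegrable _ _))
  rw [intervalIntegral.integral_add (i1.sub (c2.intervalIntegrable _ _))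
      (c3.intervalIntegrable _ _), intervalIntegral.integral_sub i1 (c2.intervalIntegrable _ _),
    integral_log_sin_zero_pi, intervalIntegral.integral_const_mul, integral_cos_sq] at ftc
  simp at ftc
  linarith

lemma continuous_slogs : Continuous fun θ => (1 - Real.cos θ) * Real.log (1 - Real.cos θ) :=
  Real.continuous_mul_log.comp (continuous_const.sub Real.continuous_cos)

lemma av_slogs : av (fun θ => (1 - Real.cos θ) * Real.log (1 - Real.cos θ)) = 1 - Real.log 2 := by
  unfold av
  have h := intervalIntegral.integral_comp_mul_left (a := 0) (b := π)
    (fun θ => (1 - Real.cos θ) * Real.log (1 - Real.cos θ)) (c := 2) (by norm_num)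
  have e : ∀ t : ℝ, (1 - Real.cos (2 * t)) * Real.log (1 - Real.cos (2 * t))
      = (2 * Real.log 2) * Real.sin t ^ 2 + 4 * (Real.sin t ^ 2 * Real.log (Real.sin t)) := by
    intro t
    have e1 : 1 - Real.cos (2 * t) = 2 * Real.sin t ^ 2 := by
      rw [Real.cos_two_mul]; linarith [Real.sin_sq_add_cos_sq t]
    rw [e1]
    by_cases hs : Real.sin t = 0
    · simp [hs]
    · rw [Real.log_mul (by norm_num) (by positivity), Real.log_pow]; push_cast; ring
  simp only [e, mul_zero] at h
  have c2 : Continuous fun t : ℝ => 4 * (Real.sin t ^ 2 * Real.log (Real.sin t)) := by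
    have hcl : Continuous fun t : ℝ => Real.sin t * Real.log (Real.sin t) :=
      Real.continuous_mul_log.comp Real.continuous_sin
    have : (fun t : ℝ => 4 * (Real.sin t ^ 2 * Real.log (Real.sin t)))
      = fun t => 4 * (Real.sin t * (Real.sin t * Real.log (Real.sin t))) := by
        ext t; ring
    rw [this]; fun_prop
  rw [intervalIntegral.integral_add (by apply Continuous.intervalIntegrable; fun_prop)
    (c2.intervalIntegrable _ _), intervalIntegral.integral_const_mul,
    intervalIntegral.integral_const_mul, int_sin_sq_log, integral_sin_sq] at h
  simp only [smul_eq_mul] at h ⊢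
  simp at h
  have hpi := Real.pi_pos.ne'
  have h2 : ∫ θ in (0:ℝ)..2 * π, (1 - Real.cos θ) * Real.log (1 - Real.cos θ)
    = 2 * π * (1 - Real.log 2) := by linarith
  rw [h2]; field_simp

/-- Szegő polynomials. -/
def PP (u : ℕ → ℝ) : ℕ → ℝ[X] × ℝ[X]
  | 0 => (1, 1)
  | k + 1 => (X * (PP u k).1 - C (u (k+1)) * (PP u k).2,
      (PP u k).2 - C (u (k+1)) * (X * (PP u k).1))

def Ph (u : ℕ → ℝ) (k : ℕ) (z : ℂ) : ℂ := aeval z (PP u k).1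
def Ps (u : ℕ → ℝ) (k : ℕ) (z : ℂ) : ℂ := aeval z (PP u k).2

lemma Ph_zero (u : ℕ → ℝ) (z : ℂ) : Ph u 0 z = 1 := by simp [Ph, PP]
lemma Ps_zero (u : ℕ → ℝ) (z : ℂ) : Ps u 0 z = 1 := by simp [Ps, PP]
lemma Ph_succ (u : ℕ → ℝ) (k : ℕ) (z : ℂ) :
    Ph u (k+1) z = z * Ph u k z - u (k+1) * Ps u k z := by simp [Ph, Ps, PP]
lemma Ps_succ (u : ℕ → ℝ) (k : ℕ) (z : ℂ) :
    Ps u (k+1) z = Ps u k z - u (k+1) * (z * Ph u k z) := by simp [Ph, Ps, PP]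

lemma Ph_diff (u : ℕ → ℝ) (k : ℕ) : Differentiable ℂ (Ph u k) := Polynomial.differentiable_aeval _
lemma Ps_diff (u : ℕ → ℝ) (k : ℕ) : Differentiable ℂ (Ps u k) := Polynomial.differentiable_aeval _
@[fun_prop] lemma Ph_cont (u : ℕ → ℝ) (k : ℕ) : Continuous (Ph u k) := (Ph_diff u k).continuous
@[fun_prop] lemma Ps_cont (u : ℕ → ℝ) (k : ℕ) : Continuous (Ps u k) := (Ps_diff u k).continuous
@[fun_prop] lemma ctheta_cont : Continuous ctheta := by unfold ctheta; fun_prop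

lemma norm_ctheta (θ : ℝ) : ‖ctheta θ‖ = 1 := Complex.norm_exp_ofReal_mul_I θ

lemma conj_mul_ctheta (θ : ℝ) : conj (ctheta θ) * ctheta θ = 1 := by
  rw [← Complex.normSq_eq_conj_mul_self, Complex.normSq_eq_norm_sq, norm_ctheta]; simp

lemma PP_facts (u : ℕ → ℝ) (h0 : u 0 = -1) (k : ℕ) :
    ((PP u k).1.natDegree ≤ k ∧ (PP u k).2.natDegree ≤ k) ∧
    ((PP u k).1.coeff k = 1 ∧ (PP u k).2.coeff k = - u k) := by
  induction k with
  | zero => simp [PP, h0]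
  | succ k ih =>
    obtain ⟨⟨h1, h2⟩, h3, h4⟩ := ih
    have e2 : (PP u k).2.coeff (k+1) = 0 := coeff_eq_zero_of_natDegree_lt (by omega)
    refine ⟨⟨?_, ?_⟩, ?_, ?_⟩
    · refine (natDegree_sub_le _ _).trans (max_le ?_ ?_)
      · refine natDegree_mul_le.trans ?_
        have := natDegree_X_le (R := ℝ); omega
      · exact (natDegree_C_mul_le _ _).trans (by omega)
    · refine (natDegree_sub_le _ _).trans (max_le (by omega) ?_)
      refine (natDegree_C_mul_le _ _).trans (natDegree_mul_le.trans ?_)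
      have := natDegree_X_le (R := ℝ); omega
    · simp [PP, coeff_X_mul, e2, h3]
    · simp [PP, coeff_X_mul, e2, h3]

lemma PP_at_zero (u : ℕ → ℝ) (h0 : u 0 = -1) (k : ℕ) : Ph u k 0 = - u k ∧ Ps u k 0 = 1 := by
  induction k with
  | zero => simp [Ph_zero, Ps_zero, h0]
  | succ k ih => rw [Ph_succ, Ps_succ, ih.1, ih.2]; simp

section disc
variable (u : ℕ → ℝ) (hu : ∀ k, u (k+1) ∈ Ioo (-1 : ℝ) 1)
include hu

lemma PP_disc (k : ℕ) (z : ℂ) (hz : ‖z‖ ≤ 1) : Ps u k z ≠ 0 ∧ ‖Ph u k z‖ ≤ ‖Ps u k z‖ := by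
  induction k with
  | zero => simp [Ph_zero, Ps_zero]
  | succ k ih =>
    obtain ⟨hB, hA⟩ := ih
    obtain ⟨hu1, hu2⟩ := hu k
    have hA' : ‖z * Ph u k z‖ ≤ ‖Ps u k z‖ := by
      rw [norm_mul]
      exact (mul_le_of_le_one_left (norm_nonneg _) hz).trans hA
    rw [Ph_succ, Ps_succ]
    set A := z * Ph u k z
    set B := Ps u k z
    set a := u (k+1)
    have hBp : 0 < ‖B‖ := norm_pos_iff.2 hB
    constructor
    · intro h
      have : B = a * A := by linear_combination h
      have h2 : ‖B‖ = |a| * ‖A‖ := by rw [this, norm_mul]; simp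
      have h3 : |a| < 1 := abs_lt.2 ⟨hu1, hu2⟩
      nlinarith [abs_nonneg a, norm_nonneg A]
    · rw [← sq_le_sq₀ (norm_nonneg _) (norm_nonneg _)]
      rw [← sq_le_sq₀ (norm_nonneg _) (norm_nonneg _)] at hA'
      rw [← Complex.normSq_eq_norm_sq, ← Complex.normSq_eq_norm_sq] at hA' ⊢
      simp only [Complex.normSq_apply, Complex.sub_re, Complex.sub_im, Complex.mul_re,
        Complex.mul_im, Complex.ofReal_re, Complex.ofReal_im] at hA' ⊢
      have : 0 < 1 - a ^ 2 := by nlinarith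
      nlinarith [mul_nonneg this.le (sub_nonneg.2 hA')]
end disc

lemma PP_star (u : ℕ → ℝ) (k : ℕ) (θ : ℝ) :
    Ph u k (ctheta θ) = ctheta θ ^ k * conj (Ps u k (ctheta θ)) ∧
    Ps u k (ctheta θ) = ctheta θ ^ k * conj (Ph u k (ctheta θ)) := by
  induction k with
  | zero => simp [Ph_zero, Ps_zero]
  | succ k ih =>
    have hz := conj_mul_ctheta θ
    rw [Ph_succ, Ps_succ]
    simp only [map_sub, map_mul, Complex.conj_ofReal]
    constructor
    · linear_combination ctheta θ * ih.1 - u (k+1) * ih.2 +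
        u (k+1) * ctheta θ ^ k * conj (Ph u k (ctheta θ)) * hz
    · linear_combination ih.2 - u (k+1) * ctheta θ * ih.1
        - ctheta θ ^ k * conj (Ph u k (ctheta θ)) * hz

lemma av_mv (F : ℂ → ℂ) (hF : DiffContOnCl ℂ F (Metric.ball 0 1)) :
    av (fun θ => F (ctheta θ)) = F 0 := by
  have h := DiffContOnCl.circleAverage (f := F) (c := 0) (R := 1) (by simpa using hF)
  rw [← h]
  simp [av, circleAverage, circleMap, ctheta]

def cc (u : ℕ → ℝ) (n : ℕ) : ℝ := ∏ k ∈ Finset.range n, (1 - u (k+1) ^ 2)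

def WW (u : ℕ → ℝ) (N : ℕ) (θ : ℝ) : ℝ := cc u N / Complex.normSq (Ps u N (ctheta θ))

def EE (u : ℕ → ℝ) (N : ℕ) (F : ℝ → ℂ) : ℂ := av fun θ => (WW u N θ : ℂ) * F θ

section wt
variable (u : ℕ → ℝ) (hu : ∀ k, u (k+1) ∈ Ioo (-1 : ℝ) 1)
include hu

lemma one_sub_sq_pos (k : ℕ) : 0 < 1 - u (k+1) ^ 2 := by
  obtain ⟨h1, h2⟩ := hu k
  nlinarith

lemma cc_pos (n : ℕ) : 0 < cc u n := Finset.prod_pos fun k _ => one_sub_sq_pos u hu k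

lemma Ps_ne (N : ℕ) (θ : ℝ) : Ps u N (ctheta θ) ≠ 0 := (PP_disc u hu N _ (norm_ctheta θ).le).1

lemma nsq_pos (N : ℕ) (θ : ℝ) : 0 < Complex.normSq (Ps u N (ctheta θ)) :=
  Complex.normSq_pos.2 (Ps_ne u hu N θ)

lemma WW_pos (N : ℕ) (θ : ℝ) : 0 < WW u N θ := div_pos (cc_pos u hu N) (nsq_pos u hu N θ)

lemma WW_cont (N : ℕ) : Continuous (WW u N) := by
  unfold WW
  refine continuous_const.div (Complex.continuous_normSq.comp (by fun_prop))
    fun θ => (nsq_pos u hu N θ).ne'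

lemma EE_add (N : ℕ) {F G : ℝ → ℂ} (hF : Continuous F) (hG : Continuous G) :
    EE u N (fun θ => F θ + G θ) = EE u N F + EE u N G := by
  have := WW_cont u hu N
  unfold EE
  rw [← av_add (by fun_prop) (by fun_prop)]
  simp only [mul_add]

lemma EE_sum (N : ℕ) {ι : Type*} (s : Finset ι) {F : ι → ℝ → ℂ} (hF : ∀ i ∈ s, Continuous (F i)) :
    EE u N (fun θ => ∑ i ∈ s, F i θ) = ∑ i ∈ s, EE u N (F i) := by
  have := WW_cont u hu N
  unfold EE
  rw [← av_sum s (fun i hi => by have := hF i hi; fun_prop)]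
  simp only [Finset.mul_sum]

omit hu in
lemma EE_mul (N : ℕ) (c : ℂ) (F : ℝ → ℂ) :
    EE u N (fun θ => c * F θ) = c * EE u N F := by
  unfold EE
  rw [← av_mul_left]
  congr 1; ext θ; ring

lemma EE_conj (N : ℕ) {F : ℝ → ℂ} (hF : Continuous F) :
    EE u N (fun θ => conj (F θ)) = conj (EE u N F) := by
  have := WW_cont u hu N
  unfold EE
  rw [← av_conj (by fun_prop)]
  simp

lemma EE_base (N i : ℕ) : EE u N (fun θ => ctheta θ ^ i * conj (Ps u N (ctheta θ)))
    = if i = 0 then (cc u N : ℂ) else 0 := by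
  unfold EE
  have e : ∀ θ, (WW u N θ : ℂ) * (ctheta θ ^ i * conj (Ps u N (ctheta θ)))
      = (fun z => (cc u N : ℂ) * (z ^ i / Ps u N z)) (ctheta θ) := by
    intro θ
    have h1 := Ps_ne u hu N θ
    have h2 : conj (Ps u N (ctheta θ)) ≠ 0 := by simpa using h1
    simp only [WW, Complex.ofReal_div, ← Complex.mul_conj]
    field_simp
  simp only [e]
  rw [av_mv (fun z => (cc u N : ℂ) * (z ^ i / Ps u N z))]
  · by_cases hi : i = 0
    · have h1 : Ps u N 0 = 1 := by
        clear e
        induction N with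
        | zero => simp [Ps_zero]
        | succ k ih => rw [Ps_succ, ih]; simp
      simp [hi, h1]
    · simp [hi]
  · have hb : ∀ z ∈ closure (Metric.ball (0:ℂ) 1), Ps u N z ≠ 0 := by
      intro z hz
      rw [closure_ball _ one_ne_zero] at hz
      exact (PP_disc u hu N z (by simpa using hz)).1
    refine ⟨fun z hz => ?_, fun z hz => ?_⟩
    · have := hb z (subset_closure hz)
      have h3 := (Ps_diff u N) z
      exact (((differentiable_id.pow i) z).div h3 this).const_mul _ |>.differentiableWithinAt
    · exact (continuousAt_const.mul
        ((continuousAt_id.pow i).div (Ps_cont u N).continuousAt (hb z hz))).continuousWithinAt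

lemma EE_orth (N d : ℕ) : ∀ j, j + d = N →
    (∀ i < j, EE u N (fun θ => conj (ctheta θ) ^ i * Ph u j (ctheta θ)) = 0) ∧
    (∀ i, 1 ≤ i → i ≤ j → EE u N (fun θ => conj (ctheta θ) ^ i * Ps u j (ctheta θ)) = 0) ∧
    EE u N (fun θ => conj (ctheta θ) ^ j * Ph u j (ctheta θ)) = cc u j := by
  induction d with
  | zero =>
    rintro j rfl
    simp only [add_zero]
    have key : ∀ i ≤ j, ∀ θ, conj (ctheta θ) ^ i * Ph u j (ctheta θ) =
        ctheta θ ^ (j - i) * conj (Ps u j (ctheta θ)) := by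
      intro i hi θ
      rw [(PP_star u j θ).1]
      have h1 : conj (ctheta θ) ^ i * ctheta θ ^ i = 1 := by
        rw [← mul_pow, conj_mul_ctheta, one_pow]
      have h2 : ctheta θ ^ j = ctheta θ ^ i * ctheta θ ^ (j - i) := by
        rw [← pow_add]; congr 1; omega
      rw [h2]
      linear_combination ctheta θ ^ (j - i) * conj (Ps u j (ctheta θ)) * h1
    refine ⟨fun i hi => ?_, fun i h1 hi => ?_, ?_⟩
    · simp only [key i hi.le]
      rw [EE_base u hu, if_neg (by omega)]
    · have := EE_conj u hu j (F := fun θ => ctheta θ ^ i * conj (Ps u j (ctheta θ)))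
        (by fun_prop)
      rw [EE_base u hu, if_neg (by omega)] at this
      simpa using this
    · simp only [key j le_rfl]
      rw [EE_base u hu, if_pos (by omega)]
  | succ d ih =>
    intro j hj
    obtain ⟨hA, hB, hC⟩ := ih (j+1) (by omega)
    have hp := (one_sub_sq_pos u hu j).ne'
    have hpc : ((1 - u (j+1) ^ 2 : ℝ) : ℂ) ≠ 0 := by exact_mod_cast hp
    have keyA : ∀ i, EE u N (fun θ => conj (ctheta θ) ^ i * Ph u j (ctheta θ)) =
        ((1 - u (j+1) ^ 2 : ℝ) : ℂ)⁻¹ *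
          (EE u N (fun θ => conj (ctheta θ) ^ (i+1) * Ph u (j+1) (ctheta θ)) + u (j+1) *
          EE u N (fun θ => conj (ctheta θ) ^ (i+1) * Ps u (j+1) (ctheta θ))) := by
      intro i
      rw [← EE_mul, ← EE_add u hu _ (by fun_prop) (by fun_prop), ← EE_mul]
      congr 1; ext θ
      rw [Ph_succ, Ps_succ, eq_inv_mul_iff_mul_eq₀ hpc]
      push_cast
      linear_combination -(1 - (u (j+1) : ℂ)^2) * conj (ctheta θ) ^ i * Ph u j (ctheta θ) *
        conj_mul_ctheta θ
    have keyB : ∀ i, EE u N (fun θ => conj (ctheta θ) ^ i * Ps u j (ctheta θ)) =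
        ((1 - u (j+1) ^ 2 : ℝ) : ℂ)⁻¹ *
          (EE u N (fun θ => conj (ctheta θ) ^ i * Ps u (j+1) (ctheta θ)) + u (j+1) *
          EE u N (fun θ => conj (ctheta θ) ^ i * Ph u (j+1) (ctheta θ))) := by
      intro i
      rw [← EE_mul, ← EE_add u hu _ (by fun_prop) (by fun_prop), ← EE_mul]
      congr 1; ext θ
      rw [Ph_succ, Ps_succ, eq_inv_mul_iff_mul_eq₀ hpc]
      push_cast
      ring
    refine ⟨fun i hi => ?_, fun i h1 hi => ?_, ?_⟩
    · rw [keyA, hA _ (by omega), hB _ (by omega) (by omega)]; simp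
    · rw [keyB, hA _ (by omega), hB _ (by omega) (by omega)]; simp
    · rw [keyA, hC, hB _ (by omega) (by omega)]
      rw [cc, Finset.prod_range_succ, ← cc]
      push_cast at hpc ⊢
      field_simp
      ring

lemma EE_poly (N j : ℕ) (hj : j ≤ N) (Q : ℝ[X]) (hQ : Q.natDegree ≤ j) :
    EE u N (fun θ => conj (aeval (ctheta θ) Q) * Ph u j (ctheta θ)) = Q.coeff j * cc u j := by
  obtain ⟨hA, -, hC⟩ := EE_orth u hu N (N - j) j (by omega)
  have e : ∀ θ, conj (aeval (ctheta θ) Q) * Ph u j (ctheta θ) =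
      ∑ i ∈ Finset.range (j+1), (Q.coeff i : ℂ) * (conj (ctheta θ) ^ i * Ph u j (ctheta θ)) := by
    intro θ
    rw [aeval_eq_sum_range' (Nat.lt_succ_of_le hQ), map_sum, Finset.sum_mul]
    refine Finset.sum_congr rfl fun i _ => ?_
    simp [Complex.real_smul, mul_assoc]
  simp only [e]
  rw [EE_sum u hu _ _ (fun i _ => by fun_prop)]
  simp only [EE_mul]
  rw [Finset.sum_range_succ, hC, Finset.sum_eq_zero, zero_add]
  intro i hi
  rw [hA i (Finset.mem_range.1 hi), mul_zero]

lemma EE_one (N : ℕ) : EE u N (fun _ => 1) = 1 := by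
  have := EE_poly u hu N 0 (Nat.zero_le _) 1 (by simp)
  simpa [Ph_zero, cc] using this

lemma EE_test (h0 : u 0 = -1) (N n : ℕ) (hn : n + 1 ≤ N) :
    EE u N (fun θ => (((1 - Real.cos θ) * Complex.normSq (Ps u n (ctheta θ)) : ℝ) : ℂ))
      = cc u n * (1 + u (n+1) * u n) := by
  obtain ⟨⟨d1, d2⟩, c1, c2⟩ := PP_facts u h0 n
  have f1 : EE u N (fun θ => conj (Ph u n (ctheta θ)) * Ph u n (ctheta θ)) = cc u n := by
    have := EE_poly u hu N n (by omega) _ d1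
    rw [c1] at this; simpa [Ph] using this
  have f2 : EE u N (fun θ => conj (Ps u n (ctheta θ)) * Ph u n (ctheta θ)) = -u n * cc u n := by
    have := EE_poly u hu N n (by omega) _ d2
    rw [c2] at this; simpa [Ph, Ps] using this
  have f3 : EE u N (fun θ => conj (Ph u n (ctheta θ)) * Ph u (n+1) (ctheta θ)) = 0 := by
    have := EE_poly u hu N (n+1) (by omega) (PP u n).1 (by omega)
    rw [coeff_eq_zero_of_natDegree_lt (by omega)] at this; simpa [Ph] using this
  have f4 : EE u N (fun θ => ctheta θ * (conj (Ph u n (ctheta θ)) * Ph u n (ctheta θ)))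
      = - u (n+1) * u n * cc u n := by
    have e : ∀ θ, ctheta θ * (conj (Ph u n (ctheta θ)) * Ph u n (ctheta θ)) =
        conj (Ph u n (ctheta θ)) * Ph u (n+1) (ctheta θ) +
        u (n+1) * conj (conj (Ps u n (ctheta θ)) * Ph u n (ctheta θ)) := by
      intro θ; rw [Ph_succ]; simp; ring
    simp only [e]
    rw [EE_add u hu _ (by fun_prop) (by fun_prop), EE_mul, EE_conj u hu _ (by fun_prop), f3, f2]
    simp; ring
  have f5 := EE_conj u hu N
    (F := fun θ => ctheta θ * (conj (Ph u n (ctheta θ)) * Ph u n (ctheta θ))) (by fun_prop)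
  rw [f4] at f5
  have e : ∀ θ : ℝ, (((1 - Real.cos θ) * Complex.normSq (Ps u n (ctheta θ)) : ℝ) : ℂ) =
      conj (Ph u n (ctheta θ)) * Ph u n (ctheta θ) + (-(1/2)) *
        (ctheta θ * (conj (Ph u n (ctheta θ)) * Ph u n (ctheta θ)) +
         conj (ctheta θ * (conj (Ph u n (ctheta θ)) * Ph u n (ctheta θ)))) := by
    intro θ
    have hn : Complex.normSq (Ps u n (ctheta θ)) = Complex.normSq (Ph u n (ctheta θ)) := by
      rw [(PP_star u n θ).1]
      simp [Complex.normSq_eq_norm_sq, norm_ctheta]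
    have hc : ((Real.cos θ : ℝ) : ℂ) = (ctheta θ + conj (ctheta θ)) / 2 := by
      rw [Complex.add_conj]; simp [ctheta, Complex.exp_ofReal_mul_I_re]
    rw [hn, ← Complex.normSq_eq_conj_mul_self]
    push_cast
    rw [← Complex.ofReal_cos, hc]
    simp only [map_mul, Complex.conj_ofReal]
    ring
  simp only [e]
  rw [EE_add u hu _ (by fun_prop) (by fun_prop), EE_mul, EE_add u hu _ (by fun_prop) (by fun_prop),
    f1, f4, f5]
  simp; ring
end wt

lemma ctheta_re (θ : ℝ) : (ctheta θ).re = Real.cos θ := by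
  simp [ctheta, Complex.exp_ofReal_mul_I_re]

lemma two_cos_eq (θ : ℝ) : ((2 * Real.cos θ : ℝ) : ℂ) = ctheta θ + conj (ctheta θ) := by
  rw [Complex.add_conj, ctheta_re]

lemma ctheta_ne (θ : ℝ) : ctheta θ ≠ 0 := by
  intro h; have := norm_ctheta θ; rw [h] at this; simp at this

lemma av_s_re (h : ℂ → ℂ) (hd : DiffContOnCl ℂ h (Metric.ball 0 1)) (h0 : h 0 = 0) :
    av (fun θ => (1 - Real.cos θ) * (2 * (h (ctheta θ)).re)) = - (deriv h 0).re := by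
  have hcB : ContinuousOn h (Metric.closedBall 0 1) := by
    have := hd.continuousOn; rwa [closure_ball _ one_ne_zero] at this
  have hdiff0 : DifferentiableAt ℂ h 0 :=
    hd.differentiableOn.differentiableAt (Metric.ball_mem_nhds _ one_pos)
  have ds : DiffContOnCl ℂ (dslope h 0) (Metric.ball 0 1) := by
    refine DiffContOnCl.mk_ball ?_ ?_
    · exact (Complex.differentiableOn_dslope (Metric.ball_mem_nhds _ one_pos)).2 hd.differentiableOn
    · exact (continuousOn_dslope (Metric.closedBall_mem_nhds _ one_pos)).2 ⟨hcB, hdiff0⟩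
  have zd : DiffContOnCl ℂ (fun z => z * h z) (Metric.ball 0 1) := by
    refine DiffContOnCl.mk_ball ?_ ?_
    · exact differentiableOn_id.mul hd.differentiableOn
    · exact continuousOn_id.mul hcB
  have mem : ∀ θ, ctheta θ ∈ Metric.closedBall (0:ℂ) 1 := fun θ => by simp [norm_ctheta]
  have c1 : Continuous fun θ => h (ctheta θ) := hcB.comp_continuous ctheta_cont mem
  have hcd : ∀ θ, dslope h 0 (ctheta θ) = conj (ctheta θ) * h (ctheta θ) := by
    intro θ
    rw [dslope_of_ne _ (ctheta_ne θ), slope_def_field, h0]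
    field_simp [ctheta_ne θ]
    linear_combination - h (ctheta θ) * conj_mul_ctheta θ
  have e : ∀ θ, (1 - Real.cos θ) * (2 * (h (ctheta θ)).re) =
      (2 * h (ctheta θ) - (ctheta θ * h (ctheta θ) + dslope h 0 (ctheta θ))).re := by
    intro θ
    have : 2 * h (ctheta θ) - (ctheta θ * h (ctheta θ) + dslope h 0 (ctheta θ)) =
      ((2 * (1 - Real.cos θ) : ℝ) : ℂ) * h (ctheta θ) := by
      rw [hcd]
      have := two_cos_eq θ
      push_cast at this ⊢
      linear_combination h (ctheta θ) * this
    rw [this, Complex.re_ofReal_mul]; ring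
  have cc' : Continuous fun θ => conj (ctheta θ) := Complex.continuous_conj.comp ctheta_cont
  have c2 : Continuous fun θ => dslope h 0 (ctheta θ) := by simp only [hcd]; exact cc'.mul c1
  have c3 : Continuous fun θ => 2 * h (ctheta θ) := continuous_const.mul c1
  have c4 : Continuous fun θ => ctheta θ * h (ctheta θ) := ctheta_cont.mul c1
  have c5 : Continuous fun θ => ctheta θ * h (ctheta θ) + dslope h 0 (ctheta θ) := c4.add c2
  have c6 : Continuous fun θ => 2 * h (ctheta θ) -
    (ctheta θ * h (ctheta θ) + dslope h 0 (ctheta θ)) := c3.sub c5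
  simp only [e]
  rw [av_re c6, av_sub c3 c5, av_add c4 c2,
    av_mul_left, av_mv h hd, av_mv _ zd, av_mv _ ds, dslope_same]
  simp [h0]

lemma av_log_step (u : ℕ → ℝ) (hu : ∀ k, u (k+1) ∈ Ioo (-1 : ℝ) 1) (h0 : u 0 = -1) (k : ℕ) :
    av (fun θ => (1 - Real.cos θ) *
      (2 * (Complex.log (1 - u (k+1) * (ctheta θ * (Ph u k (ctheta θ) / Ps u k (ctheta θ))))).re))
      = - (u (k+1) * u k) := by
  set h : ℂ → ℂ := fun z => Complex.log (1 - u (k+1) * (z * (Ph u k z / Ps u k z))) with hh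
  have hs : ∀ z : ℂ, ‖z‖ ≤ 1 → 1 - u (k+1) * (z * (Ph u k z / Ps u k z)) ∈ Complex.slitPlane := by
    intro z hz
    have ⟨p1, p2⟩ := PP_disc u hu k z hz
    have : ‖- (u (k+1) * (z * (Ph u k z / Ps u k z)))‖ < 1 := by
      rw [norm_neg, norm_mul, norm_mul, norm_div, Complex.norm_real]
      have h1 : ‖Ph u k z‖ / ‖Ps u k z‖ ≤ 1 := div_le_one_of_le₀ p2 (norm_nonneg _)
      have h2 : ‖u (k+1)‖ < 1 := by rw [Real.norm_eq_abs, abs_lt]; exact hu k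
      have h3 : ‖z‖ * (‖Ph u k z‖ / ‖Ps u k z‖) ≤ 1 := mul_le_one₀ hz (by positivity) h1
      calc _ ≤ ‖u (k+1)‖ * 1 := mul_le_mul_of_nonneg_left h3 (norm_nonneg _)
        _ < 1 := by linarith
    have := Complex.mem_slitPlane_of_norm_lt_one this
    rwa [← sub_eq_add_neg] at this
  have dA : ∀ z : ℂ, ‖z‖ ≤ 1 → DifferentiableAt ℂ h z := by
    intro z hz
    have ⟨p1, p2⟩ := PP_disc u hu k z hz
    refine DifferentiableAt.clog ?_ (hs z hz)
    have a1 := Ph_diff u k z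
    have a2 := Ps_diff u k z
    exact (differentiableAt_const _).sub ((differentiableAt_const _).mul
      (differentiableAt_id.mul (a1.div a2 p1)))
  have hd : DiffContOnCl ℂ h (Metric.ball 0 1) := by
    refine DiffContOnCl.mk_ball ?_ ?_
    · intro z hz
      exact (dA z (by simpa using (mem_ball_zero_iff.1 hz).le)).differentiableWithinAt
    · intro z hz
      exact (dA z (mem_closedBall_zero_iff.1 hz)).continuousAt.continuousWithinAt
  have hz0 : h 0 = 0 := by simp [hh]
  have hder : deriv h 0 = u (k+1) * u k := by
    have ⟨p1, p2⟩ := PP_disc u hu k 0 (by simp)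
    have a1 := (Ph_diff u k 0).div (Ps_diff u k 0) p1
    have a2 := ((hasDerivAt_id (0:ℂ)).mul a1.hasDerivAt).const_mul (u (k+1) : ℂ)
    have a3 := (a2.const_sub 1).clog (by simp)
    have a4 := a3.deriv
    have ⟨q1, q2⟩ := PP_at_zero u h0 k
    have : deriv h 0 = _ := a4
    rw [this]
    simp [q1, q2]
  have := av_s_re h hd hz0
  rw [this, hder]
  simp

lemma av_log (u : ℕ → ℝ) (hu : ∀ k, u (k+1) ∈ Ioo (-1 : ℝ) 1) (h0 : u 0 = -1) (N : ℕ) :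
    av (fun θ => (1 - Real.cos θ) * Real.log (Complex.normSq (Ps u N (ctheta θ)))) =
      - ∑ k ∈ Finset.range N, u (k+1) * u k := by
  induction N with
  | zero =>
    simp [Ps_zero, av]
  | succ N ih =>
    have key : ∀ θ, Real.log (Complex.normSq (Ps u (N+1) (ctheta θ))) =
      Real.log (Complex.normSq (Ps u N (ctheta θ))) + 2 * (Complex.log (1 - u (N+1) *
        (ctheta θ * (Ph u N (ctheta θ) / Ps u N (ctheta θ))))).re := by
      intro θ
      have n1 := Ps_ne u hu N θ
      have n2 := Ps_ne u hu (N+1) θ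
      have e : Ps u (N+1) (ctheta θ) = Ps u N (ctheta θ) * (1 - u (N+1) *
        (ctheta θ * (Ph u N (ctheta θ) / Ps u N (ctheta θ)))) := by
        rw [Ps_succ]; field_simp
      have n3 : (1 - u (N+1) * (ctheta θ * (Ph u N (ctheta θ) / Ps u N (ctheta θ)))) ≠ 0 := by
        intro h; rw [h, mul_zero] at e; exact n2 e
      rw [e, Complex.normSq_mul, Real.log_mul (by simpa using n1) (by simpa using n3),
        Complex.log_re, Complex.normSq_eq_norm_sq (1 - _), Real.log_pow]
      norm_num
    have cN : ∀ N, Continuous fun θ => Real.log (Complex.normSq (Ps u N (ctheta θ))) := fun N =>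
      (Complex.continuous_normSq.comp ((Ps_cont u N).comp ctheta_cont)).log
        (fun θ => (nsq_pos u hu N θ).ne')
    have c2 : Continuous fun θ => 2 * (Complex.log (1 - u (N+1) *
        (ctheta θ * (Ph u N (ctheta θ) / Ps u N (ctheta θ))))).re := by
      have := (cN (N+1)).sub (cN N)
      refine this.congr fun θ => ?_
      have := key θ
      simp only [Pi.sub_apply]
      linarith
    have k2 : ∀ θ, (1 - Real.cos θ) * Real.log (Complex.normSq (Ps u (N+1) (ctheta θ))) =
      (1 - Real.cos θ) * Real.log (Complex.normSq (Ps u N (ctheta θ))) +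
      (1 - Real.cos θ) * (2 * (Complex.log (1 - u (N+1) *
        (ctheta θ * (Ph u N (ctheta θ) / Ps u N (ctheta θ))))).re) := by
      intro θ; rw [key θ]; ring
    simp only [k2]
    have cs : Continuous fun θ => 1 - Real.cos θ := by fun_prop
    have d1 : Continuous fun θ => (1 - Real.cos θ) * Real.log (Complex.normSq (Ps u N (ctheta θ))) :=
      cs.mul (cN N)
    have d2 : Continuous fun θ => (1 - Real.cos θ) * (2 * (Complex.log
        (1 - u (N+1) * (ctheta θ * (Ph u N (ctheta θ) / Ps u N (ctheta θ))))).re) := cs.mul c2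
    rw [av_add d1 d2, ih,
      av_log_step u hu h0 N, Finset.sum_range_succ]
    ring


def XX (u : ℕ → ℝ) : ℕ → ℂ → ℂ
  | 0 => fun _ => 1
  | (k+1) => fun z => z * Ph u k z + Ps u k z

lemma XX_rec (u : ℕ → ℝ) (h0 : u 0 = -1) (k : ℕ) (z : ℂ) :
    XX u (k+2) z = (z + 1) * XX u (k+1) z - ((1 - u k) * (1 + u (k+1))) * z * XX u k z := by
  cases k with
  | zero =>
    simp only [XX, Ph_succ, Ps_succ, Ph_zero, Ps_zero, h0]
    push_cast; ring
  | succ k =>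
    simp only [XX, Ph_succ, Ps_succ]
    ring

lemma XX_two (u : ℕ → ℝ) (h0 : u 0 = -1) (k : ℕ) (z : ℂ) :
    XX u (2*k+4) z = (z^2 + 1 - ((1 - u (2*k+2)) * u (2*k+3) - (1 + u (2*k+2)) * u (2*k+1)) * z)
      * XX u (2*k+2) z
      - ((1 - u (2*k)) * (1 - (u (2*k+1))^2) * (1 + u (2*k+2))) * z^2 * XX u (2*k) z := by
  have e4 := XX_rec u h0 (2*k+2) z
  have e3 := XX_rec u h0 (2*k+1) z
  have e2 := XX_rec u h0 (2*k) z
  linear_combination e4 + (z+1) * e3 + (((1 - u (2*k+1)) * (1 + u (2*k+2))) * z) * e2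

section mm
variable (μ : Measure ℝ) (u a b : ℕ → ℝ) (p : ℕ → ℝ[X])

lemma p_XX (h0 : u 0 = -1) (ha : ∀ k, 0 < a (k+1)) (p0 : p 0 = 1)
    (hrec : ∀ (k : ℕ) (x : ℝ), x * (p k).eval x =
      a (k+1) * (p (k+1)).eval x + b (k+1) * (p k).eval x +
        (if k = 0 then 0 else a k * (p (k-1)).eval x))
    (hb : ∀ k : ℕ, b (k+1) = (1 - u (2*k)) * u (2*k+1) - (1 + u (2*k)) * u (2*k-1))
    (haa : ∀ k : ℕ, (a (k+1))^2 = (1 - u (2*k)) * (1 - (u (2*k+1))^2) * (1 + u (2*k+2)))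
    (θ : ℝ) (k : ℕ) :
    ((∏ i ∈ Finset.range k, a (i+1) : ℝ) : ℂ) * (((p k).eval (2 * Real.cos θ) : ℝ) : ℂ)
      * ctheta θ ^ k = XX u (2*k) (ctheta θ) ∧
    ((∏ i ∈ Finset.range (k+1), a (i+1) : ℝ) : ℂ) * (((p (k+1)).eval (2 * Real.cos θ) : ℝ) : ℂ)
      * ctheta θ ^ (k+1) = XX u (2*k+2) (ctheta θ) := by
  have hx : ((2 * Real.cos θ : ℝ) : ℂ) * ctheta θ = ctheta θ ^ 2 + 1 := by
    rw [two_cos_eq]; linear_combination conj_mul_ctheta θ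
  induction k with
  | zero =>
    constructor
    · simp [p0, XX]
    · have r := hrec 0 (2 * Real.cos θ)
      have hb0 := hb 0
      simp [p0, h0] at r hb0
      have r' : (a 1 : ℂ) * (((p 1).eval (2 * Real.cos θ) : ℝ) : ℂ) =
        ((2 * Real.cos θ : ℝ) : ℂ) - b 1 := by
        have r2 : a 1 * (p 1).eval (2 * Real.cos θ) = 2 * Real.cos θ - b 1 := by linarith
        exact_mod_cast congrArg (fun x : ℝ => (x : ℂ)) r2
      have hb' : (b 1 : ℂ) = 2 * u 1 := by rw [hb0]; push_cast; ring
      simp [XX, Ph_succ, Ps_succ, Ph_zero, Ps_zero] 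
      push_cast at hx r' ⊢
      linear_combination ctheta θ * r' + hx - ctheta θ * hb'
  | succ k ih =>
    refine ⟨ih.2, ?_⟩
    have r := hrec (k+1) (2 * Real.cos θ)
    simp only [Nat.add_eq_zero_iff, one_ne_zero, and_false, if_false, Nat.add_sub_cancel] at r
    have r' : (a (k+2) : ℂ) * (((p (k+2)).eval (2 * Real.cos θ) : ℝ) : ℂ) =
        (((2 * Real.cos θ : ℝ) : ℂ) - b (k+2)) * (((p (k+1)).eval (2 * Real.cos θ) : ℝ) : ℂ)
        - a (k+1) * (((p k).eval (2 * Real.cos θ) : ℝ) : ℂ) := by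
      have : a (k+2) * (p (k+2)).eval (2 * Real.cos θ) =
        ((2 * Real.cos θ) - b (k+2)) * (p (k+1)).eval (2 * Real.cos θ)
        - a (k+1) * (p k).eval (2 * Real.cos θ) := by linear_combination -r
      exact_mod_cast congrArg (fun x : ℝ => (x : ℂ)) this
    have hb' : (b (k+2) : ℂ) = (1 - u (2*k+2)) * u (2*k+3) - (1 + u (2*k+2)) * u (2*k+1) := by
      have := hb (k+1)
      rw [show 2*(k+1) - 1 = 2*k+1 by omega, show 2*(k+1) = 2*k+2 by ring] at this
      rw [this]; push_cast; ring
    have ha' : (a (k+1) : ℂ)^2 = (1 - u (2*k)) * (1 - (u (2*k+1))^2) * (1 + u (2*k+2)) := by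
      have := haa k
      exact_mod_cast congrArg (fun x : ℝ => (x : ℂ)) this
    have x2 := XX_two u h0 k (ctheta θ)
    rw [show 2*(k+1)+2 = 2*k+4 by ring, x2, ← hb', ← ha', ← ih.1, ← ih.2,
      Finset.prod_range_succ _ (k+1), Finset.prod_range_succ _ k]
    push_cast at hx r' ⊢
    set c : ℂ := ∏ i ∈ Finset.range k, (a (i+1) : ℂ)
    linear_combination (c * a (k+1) * ctheta θ ^ (k+2)) * r' +
      (c * a (k+1) * ctheta θ ^ (k+1) * (((p (k+1)).eval (2 * Real.cos θ) : ℝ) : ℂ)) * hx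

end mm

lemma int_cont (μ : Measure ℝ) [IsProbabilityMeasure μ] (hs : μ (Icc (-2) 2)ᶜ = 0)
    (f : ℝ → ℝ) (hf : Continuous f) : Integrable f μ := by
  have h := hf.continuousOn.integrableOn_compact (μ := μ) (isCompact_Icc (a := (-2:ℝ)) (b := 2))
  rwa [IntegrableOn, Measure.restrict_eq_self_of_ae_mem] at h
  exact mem_ae_iff.2 hs

def RE (u : ℕ → ℝ) (N : ℕ) (f : ℝ → ℝ) : ℝ := av fun θ => WW u N θ * f θ

lemma EE_ofReal (u : ℕ → ℝ) (hu : ∀ k, u (k+1) ∈ Ioo (-1 : ℝ) 1) (N : ℕ) (f : ℝ → ℝ)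
    (hf : Continuous f) : EE u N (fun θ => (f θ : ℂ)) = (RE u N f : ℝ) := by
  have h : Continuous fun θ => WW u N θ * f θ := (WW_cont u hu N).mul hf
  unfold EE RE
  rw [← av_ofReal h]
  push_cast; rfl

lemma RE_one (u : ℕ → ℝ) (hu : ∀ k, u (k+1) ∈ Ioo (-1 : ℝ) 1) (N : ℕ) :
    RE u N (fun _ => 1) = 1 := by
  have h1 := EE_ofReal u hu N (fun _ => 1) continuous_const
  have h2 := EE_one u hu N
  simp only [Complex.ofReal_one] at h1
  rw [h2] at h1
  exact_mod_cast h1.symm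

lemma RE_add (u : ℕ → ℝ) (hu : ∀ k, u (k+1) ∈ Ioo (-1 : ℝ) 1) (N : ℕ) (f g : ℝ → ℝ)
    (hf : Continuous f) (hg : Continuous g) :
    RE u N (fun θ => f θ + g θ) = RE u N f + RE u N g := by
  have h : Continuous fun θ => WW u N θ * f θ := (WW_cont u hu N).mul hf
  have h' : Continuous fun θ => WW u N θ * g θ := (WW_cont u hu N).mul hg
  unfold RE
  rw [← av_add h h']
  simp only [mul_add]

lemma RE_mul (u : ℕ → ℝ) (N : ℕ) (c : ℝ) (f : ℝ → ℝ) :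
    RE u N (fun θ => c * f θ) = c * RE u N f := by
  unfold RE
  rw [← av_mul_left]
  congr 1; ext θ; ring

lemma RE_mono (u : ℕ → ℝ) (hu : ∀ k, u (k+1) ∈ Ioo (-1 : ℝ) 1) (N : ℕ) (f g : ℝ → ℝ)
    (hf : Continuous f) (hg : Continuous g) (h : ∀ θ, f θ ≤ g θ) : RE u N f ≤ RE u N g :=
  av_mono ((WW_cont u hu N).mul hf) ((WW_cont u hu N).mul hg)
    fun θ => mul_le_mul_of_nonneg_left (h θ) (WW_pos u hu N θ).le

lemma match_poly (μ : Measure ℝ) [IsProbabilityMeasure μ] (hs : μ (Icc (-2) 2)ᶜ = 0) (u : ℕ → ℝ)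
    (H : IsCanonicalMoments μ u) (N : ℕ) (d : ℕ) (hd : 2 * d ≤ N) :
    ∀ Q : ℝ[X], Q.natDegree ≤ d → RE u N (fun θ => Q.eval (2 * Real.cos θ)) = ∫ x, Q.eval x ∂μ := by
  obtain ⟨h0, hu, a, b, ⟨ha, p, pdeg, plc, porth, prec⟩, hb, haa⟩ := H
  have p0 : p 0 = 1 := by
    obtain ⟨c, hc⟩ := natDegree_eq_zero.1 (pdeg 0)
    have h1 := porth 0 0
    have h2 := plc 0
    rw [← hc] at h1 h2 ⊢
    simp at h1 h2
    have : c = 1 := by nlinarith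
    rw [this, map_one]
  have pint : ∀ k, 1 ≤ k → ∫ x, (p k).eval x ∂μ = 0 := by
    intro k hk
    have := porth k 0
    rw [p0, if_neg (by omega)] at this
    simpa using this
  have pRE : ∀ k, 1 ≤ k → 2 * k ≤ N → RE u N (fun θ => (p k).eval (2 * Real.cos θ)) = 0 := by
    intro k hk hkN
    obtain ⟨k, rfl⟩ : ∃ m, k = m + 1 := ⟨k - 1, by omega⟩
    have e := EE_ofReal u hu N (fun θ => (p (k+1)).eval (2 * Real.cos θ))
      ((p (k+1)).continuous.comp (by fun_prop))
    have C0 : ((∏ i ∈ Finset.range (k+1), a (i+1) : ℝ) : ℂ) ≠ 0 := by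
      exact_mod_cast (Finset.prod_pos fun i _ => ha i).ne'
    have key : ∀ θ, ((∏ i ∈ Finset.range (k+1), a (i+1) : ℝ) : ℂ) *
        (((p (k+1)).eval (2 * Real.cos θ) : ℝ) : ℂ) =
        conj (ctheta θ) ^ k * Ph u (2*k+1) (ctheta θ) +
        conj (ctheta θ) ^ (k+1) * Ps u (2*k+1) (ctheta θ) := by
      intro θ
      have h := (p_XX u a b p h0 ha p0 prec hb haa θ k).2
      have hz := conj_mul_ctheta θ
      have hzk : conj (ctheta θ) ^ (k+1) * ctheta θ ^ (k+1) = 1 := by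
        rw [← mul_pow, hz, one_pow]
      simp only [XX] at h
      calc _ = conj (ctheta θ) ^ (k+1) * ctheta θ ^ (k+1) *
            (((∏ i ∈ Finset.range (k+1), a (i+1) : ℝ) : ℂ) *
        (((p (k+1)).eval (2 * Real.cos θ) : ℝ) : ℂ)) := by rw [hzk, one_mul]
        _ = conj (ctheta θ) ^ (k+1) * (ctheta θ * Ph u (2*k+1) (ctheta θ) +
            Ps u (2*k+1) (ctheta θ)) := by rw [← h]; ring
        _ = _ := by linear_combination conj (ctheta θ) ^ k * Ph u (2*k+1) (ctheta θ) * hz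
    obtain ⟨hA, hB, -⟩ := EE_orth u hu N (N - (2*k+1)) (2*k+1) (by omega)
    have z : ((∏ i ∈ Finset.range (k+1), a (i+1) : ℝ) : ℂ) *
        EE u N (fun θ => (((p (k+1)).eval (2 * Real.cos θ) : ℝ) : ℂ)) = 0 := by
      rw [← EE_mul]
      simp only [key]
      rw [EE_add u hu N (by fun_prop) (by fun_prop), hA k (by omega), hB (k+1) (by omega) (by omega),
        add_zero]
    rw [e] at z
    have := (mul_eq_zero.1 z).resolve_left C0
    exact_mod_cast this
  induction d with
  | zero =>
    intro Q hQ
    obtain ⟨c, rfl⟩ := natDegree_eq_zero.1 (Nat.le_zero.1 hQ)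
    simp only [eval_C]
    have := RE_mul u N c (fun _ => 1)
    rw [RE_one u hu] at this
    simpa using this
  | succ d ih =>
    intro Q hQ
    set c := Q.coeff (d+1) / (p (d+1)).leadingCoeff with hc
    have hdeg : (Q - C c * p (d+1)).natDegree ≤ d := by
      rw [natDegree_le_iff_coeff_eq_zero]
      intro m hm
      rcases Nat.lt_or_ge (d+1) m with h | h
      · rw [coeff_sub, coeff_C_mul, coeff_eq_zero_of_natDegree_lt (by omega),
          coeff_eq_zero_of_natDegree_lt (by rw [pdeg]; omega)]
        simp
      · obtain rfl : m = d + 1 := by omega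
        have : (p (d+1)).coeff (d+1) = (p (d+1)).leadingCoeff := by
          rw [leadingCoeff, pdeg]
        rw [coeff_sub, coeff_C_mul, this, hc, div_mul_cancel₀ _ (plc _).ne', sub_self]
    have i1 := ih (by omega) _ hdeg
    have e1 : ∀ x, Q.eval x = (Q - C c * p (d+1)).eval x + c * (p (d+1)).eval x := by
      intro x; simp
    simp only [e1]
    have cp : ∀ R : ℝ[X], Continuous fun θ => R.eval (2 * Real.cos θ) := fun R =>
      R.continuous.comp (by fun_prop : Continuous fun θ => 2 * Real.cos θ)
    have c2 : Continuous fun θ => c * (p (d+1)).eval (2 * Real.cos θ) := continuous_const.mul (cp _)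
    have c3 : Continuous fun x => c * (p (d+1)).eval x := continuous_const.mul (p (d+1)).continuous
    rw [RE_add u hu N _ _ (cp _) c2, RE_mul,
      pRE _ (by omega) hd, i1, integral_add (int_cont μ hs _ (Polynomial.continuous _))
        (int_cont μ hs _ c3), integral_const_mul,
      pint _ (by omega)]


lemma poly_cos (Q : ℝ[X]) : ∃ A B : ℝ[X], ∀ θ : ℝ, aeval (ctheta θ) Q =
    ((A.eval (Real.cos θ) : ℝ) : ℂ) + Complex.I * (Real.sin θ * B.eval (Real.cos θ) : ℝ) := by
  induction Q using Polynomial.induction_on with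
  | C a => exact ⟨C a, 0, fun θ => by simp⟩
  | add p q hp hq =>
    obtain ⟨A, B, h⟩ := hp
    obtain ⟨A', B', h'⟩ := hq
    refine ⟨A + A', B + B', fun θ => ?_⟩
    rw [map_add, h, h']
    simp only [eval_add]; push_cast; ring
  | monomial n a h =>
    obtain ⟨A, B, h⟩ := h
    refine ⟨X * A - (1 - X ^ 2) * B, A + X * B, fun θ => ?_⟩
    have e : ctheta θ = Real.cos θ + Real.sin θ * Complex.I := by
      rw [ctheta, Complex.exp_mul_I]; push_cast; ring
    have hs : (Real.sin θ : ℂ)^2 = 1 - (Real.cos θ : ℂ)^2 := by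
      exact_mod_cast congrArg (fun x : ℝ => (x : ℂ)) (Real.sin_sq θ)
    rw [pow_succ, ← mul_assoc, map_mul, h, aeval_X, e]
    simp only [eval_add, eval_mul, eval_sub, eval_X, eval_one, eval_pow]
    push_cast at hs ⊢
    linear_combination (((eval (Real.cos θ) B : ℝ) : ℂ) * Complex.sin θ ^ 2) * Complex.I_sq
      - (((eval (Real.cos θ) B : ℝ) : ℂ)) * hs

lemma exists_g (u : ℕ → ℝ) (n : ℕ) : ∃ g : ℝ[X], ∀ θ : ℝ, g.eval (2 * Real.cos θ) =
    (1 - Real.cos θ) * Complex.normSq (Ps u n (ctheta θ)) := by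
  obtain ⟨A, B, h⟩ := poly_cos (PP u n).2
  refine ⟨((1 - X) * (A ^ 2 + (1 - X ^ 2) * B ^ 2)).comp (C (1/2) * X), fun θ => ?_⟩
  have e : Complex.normSq (Ps u n (ctheta θ)) =
      A.eval (Real.cos θ) ^ 2 + (1 - Real.cos θ ^ 2) * B.eval (Real.cos θ) ^ 2 := by
    rw [Ps, h, mul_comm Complex.I, Complex.normSq_add_mul_I, ← Real.sin_sq]; ring
  rw [e]
  simp

def KK (u : ℕ → ℝ) (N : ℕ) : ℝ :=
  1 - Real.log 2 - (∑ k ∈ Finset.range N, u (k+1) * u k) - Real.log (cc u N)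

lemma KK_av (u : ℕ → ℝ) (hu : ∀ k, u (k+1) ∈ Ioo (-1 : ℝ) 1) (h0 : u 0 = -1) (N : ℕ) :
    (Continuous fun θ => (1 - Real.cos θ) * Real.log (1 - Real.cos θ) + (1 - Real.cos θ) *
      (Real.log (Complex.normSq (Ps u N (ctheta θ))) - Real.log (cc u N))) ∧
    av (fun θ => (1 - Real.cos θ) * Real.log (1 - Real.cos θ) + (1 - Real.cos θ) *
      (Real.log (Complex.normSq (Ps u N (ctheta θ))) - Real.log (cc u N))) = KK u N := by
  have cN : Continuous fun θ => Real.log (Complex.normSq (Ps u N (ctheta θ))) :=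
      (Complex.continuous_normSq.comp ((Ps_cont u N).comp ctheta_cont)).log
        (fun θ => (nsq_pos u hu N θ).ne')
  have cs : Continuous fun θ => 1 - Real.cos θ := by fun_prop
  have d1 : Continuous fun θ => (1 - Real.cos θ) * Real.log (Complex.normSq (Ps u N (ctheta θ))) :=
    cs.mul cN
  have d2 : Continuous fun θ => Real.log (cc u N) * (1 - Real.cos θ) := continuous_const.mul cs
  have d3 : Continuous fun θ => (1 - Real.cos θ) * Real.log (Complex.normSq (Ps u N (ctheta θ)))
    - Real.log (cc u N) * (1 - Real.cos θ) := d1.sub d2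
  have e : ∀ θ, (1 - Real.cos θ) * (Real.log (Complex.normSq (Ps u N (ctheta θ)))
      - Real.log (cc u N)) = (1 - Real.cos θ) * Real.log (Complex.normSq (Ps u N (ctheta θ)))
    - Real.log (cc u N) * (1 - Real.cos θ) := fun θ => by ring
  simp only [e]
  refine ⟨continuous_slogs.add d3, ?_⟩
  rw [av_add continuous_slogs d3, av_sub d1 d2, av_slogs, av_log u hu h0, av_mul_left,
    av_one_sub_cos, KK]
  ring

section bounds
variable (μ : Measure ℝ) [IsProbabilityMeasure μ] (u : ℕ → ℝ)

lemma int_g (hs : μ (Icc (-2) 2)ᶜ = 0) (H : IsCanonicalMoments μ u) (n : ℕ) (g : ℝ[X])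
    (hg : ∀ θ : ℝ, g.eval (2 * Real.cos θ) =
      (1 - Real.cos θ) * Complex.normSq (Ps u n (ctheta θ))) :
    ∫ x, g.eval x ∂μ = cc u n * (1 + u (n+1) * u n) := by
  have ⟨h0, hu, _⟩ := H
  set N := max (2 * g.natDegree) (n+1)
  rw [← match_poly μ hs u H N g.natDegree (le_max_left _ _) g le_rfl]
  have t := EE_test u hu h0 N n (le_max_right _ _)
  simp only [← hg] at t
  have cg : Continuous fun θ => g.eval (2 * Real.cos θ) :=
    g.continuous.comp (by fun_prop : Continuous fun θ => 2 * Real.cos θ)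
  rw [EE_ofReal u hu N _ cg] at t
  exact_mod_cast t

lemma cos_surj (x : ℝ) (hx : x ∈ Icc (-2 : ℝ) 2) : ∃ θ, 2 * Real.cos θ = x :=
  ⟨Real.arccos (x/2), by
    rw [Real.cos_arccos (by linarith [hx.1]) (by linarith [hx.2])]; ring⟩

lemma lower_bd (hs : μ (Icc (-2) 2)ᶜ = 0) (H : IsCanonicalMoments μ u)
    (hk : InformationTheory.klDiv Dhard μ ≠ ⊤) (n : ℕ) :
    KK u n ≤ (InformationTheory.klDiv Dhard μ).toReal + u (n+1) * u n := by
  have ⟨h0, hu, _⟩ := H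
  obtain ⟨g, hg⟩ := exists_g u n
  have hI := int_g μ u hs H n g hg
  have hc := cc_pos u hu n
  refine le_of_forall_pos_le_add fun ε hε => ?_
  have gpos : ∀ x ∈ Icc (-2 : ℝ) 2, 0 ≤ g.eval x := by
    intro x hx
    obtain ⟨θ, rfl⟩ := cos_surj x hx
    rw [hg]
    exact mul_nonneg (by linarith [Real.cos_le_one θ]) (Complex.normSq_nonneg _)
  set cl : ℝ → ℝ := fun x => max (-2) (min 2 x) with hcl
  have clc : Continuous cl := by fun_prop
  have clm : ∀ x, cl x ∈ Icc (-2 : ℝ) 2 := fun x =>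
    ⟨le_max_left _ _, max_le (by norm_num) (min_le_left _ _)⟩
  have cle : ∀ x ∈ Icc (-2 : ℝ) 2, cl x = x := fun x hx => by
    simp only [hcl]; rw [min_eq_right hx.2, max_eq_right hx.1]
  have pos : ∀ x, 0 < g.eval (cl x) / cc u n + ε := fun x =>
    add_pos_of_nonneg_of_pos (div_nonneg (gpos _ (clm x)) hc.le) hε
  set f : ℝ → ℝ := fun x => Real.log (g.eval (cl x) / cc u n + ε) with hf
  have fc : Continuous f :=
    (((g.continuous.comp clc).div_const _).add continuous_const).log fun x => (pos x).ne'
  obtain ⟨M, hM⟩ := (isCompact_Icc (a := (-2:ℝ)) (b := 2)).exists_bound_of_continuousOn fc.continuousOn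
  have fb : ∀ x, |f x| ≤ M := by
    intro x
    have h1 := hM (cl x) (clm x)
    have : f (cl x) = f x := by simp only [hf]; rw [cle _ (clm x)]
    rwa [this] at h1
  have L := kl_dual_lower Dhard μ hk f fc.measurable M fb
  have i1 : ∫ x, Real.exp (f x) ∂μ = 1 + u (n+1) * u n + ε := by
    have : ∫ x, Real.exp (f x) ∂μ = ∫ x, (g.eval x / cc u n + ε) ∂μ := by
      refine integral_congr_ae ?_
      have hm : ∀ᵐ x ∂μ, x ∈ Icc (-2 : ℝ) 2 := mem_ae_iff.2 hs
      filter_upwards [hm] with x hx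
      simp only [hf]
      rw [Real.exp_log (pos x), cle x hx]
    rw [this, integral_add ((int_cont μ hs _ g.continuous).div_const _) (integrable_const _),
      integral_div, hI]
    simp
    field_simp
  have i2 : KK u n ≤ ∫ x, f x ∂Dhard := by
    obtain ⟨c1, e1⟩ := KK_av u hu h0 n
    rw [Dhard_integral f fc, ← e1]
    refine av_mono c1 ((fc.comp (by fun_prop : Continuous fun θ => 2 * Real.cos θ)).mul
      (by fun_prop : Continuous fun θ => 1 - Real.cos θ)) fun θ => ?_
    have m : 2 * Real.cos θ ∈ Icc (-2 : ℝ) 2 :=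
      ⟨by linarith [Real.neg_one_le_cos θ], by linarith [Real.cos_le_one θ]⟩
    have s0 : 0 ≤ 1 - Real.cos θ := by linarith [Real.cos_le_one θ]
    have np := nsq_pos u hu n θ
    simp only [hf]
    rw [cle _ m, hg, ← mul_add, mul_comm (Real.log _)]
    rcases s0.eq_or_lt with h | h
    · rw [← h]; simp
    · refine mul_le_mul_of_nonneg_left ?_ s0
      rw [← Real.log_div np.ne' hc.ne', ← Real.log_mul h.ne' (div_pos np hc).ne']
      refine Real.log_le_log (mul_pos h (div_pos np hc)) ?_
      rw [mul_div_assoc]; linarith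
  linarith

lemma upper_pt (s G f : ℝ) (hs : 0 ≤ s) (hG : 0 < G) :
    s * f + s ≤ s * Real.log s + s * Real.log G + G⁻¹ * Real.exp f := by
  rcases hs.eq_or_lt with h | h
  · rw [← h]; simp; positivity
  · have y : 0 < Real.exp f / (s * G) := by positivity
    have := Real.log_le_sub_one_of_pos y
    rw [Real.log_div (Real.exp_pos f).ne' (by positivity), Real.log_exp,
      Real.log_mul h.ne' hG.ne'] at this
    have h2 := mul_le_mul_of_nonneg_left this hs
    have h3 : s * (Real.exp f / (s * G)) = G⁻¹ * Real.exp f := by field_simp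
    linarith [mul_sub s (Real.exp f / (s * G)) 1]

lemma upper_bd (hu : ∀ k, u (k+1) ∈ Ioo (-1 : ℝ) 1) (h0 : u 0 = -1) (f : ℝ → ℝ)
    (hf : Continuous f) (N : ℕ) :
    ∫ x, f x ∂Dhard + 1 ≤ KK u N + RE u N (fun θ => Real.exp (f (2 * Real.cos θ))) := by
  obtain ⟨c1, e1⟩ := KK_av u hu h0 N
  have hc := cc_pos u hu N
  have cf : Continuous fun θ => f (2 * Real.cos θ) := hf.comp (by fun_prop)
  have cs : Continuous fun θ => 1 - Real.cos θ := by fun_prop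
  have c2 : Continuous fun θ => f (2 * Real.cos θ) * (1 - Real.cos θ) := cf.mul cs
  have c3 : Continuous fun θ => WW u N θ * Real.exp (f (2 * Real.cos θ)) :=
    (WW_cont u hu N).mul (Real.continuous_exp.comp cf)
  have h1 : ∫ x, f x ∂Dhard + 1 =
      av (fun θ => f (2 * Real.cos θ) * (1 - Real.cos θ)) + av (fun θ => 1 - Real.cos θ) := by
    rw [Dhard_integral f hf, av_one_sub_cos]
  rw [h1, ← e1, RE, ← av_add c2 cs, ← av_add c1 c3]
  refine av_mono (c2.add cs) (c1.add c3) fun θ => ?_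
  have s0 : 0 ≤ 1 - Real.cos θ := by linarith [Real.cos_le_one θ]
  have np := nsq_pos u hu N θ
  have := upper_pt (1 - Real.cos θ) (Complex.normSq (Ps u N (ctheta θ)) / cc u N)
    (f (2 * Real.cos θ)) s0 (div_pos np hc)
  rw [Real.log_div np.ne' hc.ne', inv_div] at this
  simp only [WW]
  linarith

lemma RE_conv (hs : μ (Icc (-2) 2)ᶜ = 0) (H : IsCanonicalMoments μ u) (φ : ℝ → ℝ)
    (hφ : Continuous φ) (ε : ℝ) (hε : 0 < ε) : ∃ N0, ∀ N ≥ N0,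
    RE u N (fun θ => φ (2 * Real.cos θ)) ≤ ∫ x, φ x ∂μ + ε := by
  have ⟨h0, hu, _⟩ := H
  obtain ⟨p, hp⟩ := exists_polynomial_near_of_continuousOn (-2) 2 φ hφ.continuousOn (ε/2) (by positivity)
  refine ⟨2 * p.natDegree, fun N hN => ?_⟩
  have e := match_poly μ hs u H N p.natDegree hN p le_rfl
  have m : ∀ θ, 2 * Real.cos θ ∈ Icc (-2 : ℝ) 2 := fun θ =>
      ⟨by linarith [Real.neg_one_le_cos θ], by linarith [Real.cos_le_one θ]⟩
  have cc2 : Continuous fun θ => 2 * Real.cos θ := by fun_prop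
  have cp : Continuous fun θ => p.eval (2 * Real.cos θ) := p.continuous.comp cc2
  have cc3 : Continuous fun _ : ℝ => (ε/2) * (1:ℝ) := continuous_const
  have r1 : RE u N (fun θ => φ (2 * Real.cos θ)) ≤
      RE u N (fun θ => p.eval (2 * Real.cos θ) + (ε/2) * 1) :=
    RE_mono u hu N _ _ (hφ.comp cc2) (cp.add cc3) fun θ => by
      have := abs_lt.1 (hp _ (m θ)); linarith
  rw [RE_add u hu N _ _ cp cc3, RE_mul u N (ε/2) (fun _ => 1), RE_one u hu, e] at r1
  have r2 : ∫ x, p.eval x ∂μ ≤ ∫ x, (φ x + ε/2) ∂μ := by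
    refine integral_mono_ae (int_cont μ hs _ p.continuous)
      ((int_cont μ hs _ hφ).add (integrable_const _)) ?_
    have hm : ∀ᵐ x ∂μ, x ∈ Icc (-2 : ℝ) 2 := mem_ae_iff.2 hs
    filter_upwards [hm] with x hx
    have := abs_lt.1 (hp _ hx); linarith
  rw [integral_add (int_cont μ hs _ hφ) (integrable_const _)] at r2
  simp at r2
  linarith

lemma upper_fin (hs : μ (Icc (-2) 2)ᶜ = 0) (H : IsCanonicalMoments μ u) (S : ℝ)
    (hS : Tendsto (KK u) atTop (𝓝 S)) :
    InformationTheory.klDiv Dhard μ ≤ ENNReal.ofReal S := by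
  have ⟨h0, hu, _⟩ := H
  refine kl_dual_upper Dhard μ S fun f hf _ => ?_
  refine le_of_forall_pos_le_add fun ε hε => ?_
  obtain ⟨N0, hN0⟩ := RE_conv μ u hs H (fun x => Real.exp (f x)) (Real.continuous_exp.comp hf)
    (ε/2) (by positivity)
  have ev := (hS.eventually (gt_mem_nhds (show S < S + ε/2 by linarith))).and (eventually_ge_atTop N0)
  obtain ⟨N, h1, h2⟩ := ev.exists
  have a := upper_bd u hu h0 f hf N
  have b := hN0 N h2
  linarith

end bounds


def TT (u : ℕ → ℝ) (k : ℕ) : ℝ :=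
  (1 - u k) * (1 + u (k+1)) - Real.log ((1 - u k) * (1 + u (k+1))) - 1

section sums
variable (u : ℕ → ℝ)

lemma u_lt (hu : ∀ k, u (k+1) ∈ Ioo (-1 : ℝ) 1) (h0 : u 0 = -1) (n : ℕ) : 0 < 1 - u n := by
  cases n with
  | zero => rw [h0]; norm_num
  | succ n => linarith [(hu n).2]

lemma TT_nonneg (hu : ∀ k, u (k+1) ∈ Ioo (-1 : ℝ) 1) (h0 : u 0 = -1) (k : ℕ) : 0 ≤ TT u k := by
  have : 0 < (1 - u k) * (1 + u (k+1)) := mul_pos (u_lt u hu h0 k) (by linarith [(hu k).1])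
  have := Real.log_le_sub_one_of_pos this
  unfold TT; linarith

lemma cc_succ (n : ℕ) : cc u (n+1) = cc u n * (1 - u (n+1) ^ 2) := Finset.prod_range_succ _ _

lemma KK_eq (hu : ∀ k, u (k+1) ∈ Ioo (-1 : ℝ) 1) (h0 : u 0 = -1) (n : ℕ) :
    KK u n = (∑ k ∈ Finset.range n, TT u k) - u n - Real.log (1 - u n) := by
  induction n with
  | zero => simp [KK, cc, h0]; norm_num
  | succ n ih =>
    have a1 := u_lt u hu h0 n
    have a2 := u_lt u hu h0 (n+1)
    have a3 : 0 < 1 + u (n+1) := by linarith [(hu n).1]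
    have l1 : Real.log (1 - u (n+1) ^ 2) = Real.log (1 - u (n+1)) + Real.log (1 + u (n+1)) := by
      rw [← Real.log_mul a2.ne' a3.ne']; congr 1; ring
    rw [Finset.sum_range_succ, TT, Real.log_mul a1.ne' a3.ne']
    rw [KK] at ih ⊢
    rw [Finset.sum_range_succ, cc_succ, Real.log_mul (cc_pos u hu n).ne' (one_sub_sq_pos u hu n).ne',
      l1]
    linear_combination ih

lemma SS_le_KK (hu : ∀ k, u (k+1) ∈ Ioo (-1 : ℝ) 1) (h0 : u 0 = -1) (n : ℕ) :
    ∑ k ∈ Finset.range n, TT u k ≤ KK u n := by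
  rw [KK_eq u hu h0]
  have := Real.log_le_sub_one_of_pos (u_lt u hu h0 n)
  linarith

lemma log_quad (t : ℝ) (h0 : 0 ≤ t) (h1 : t < 1) : t ^ 2 / 4 ≤ - Real.log (1 - t) - t := by
  set w := Real.sqrt (1 - t) with hw
  have wpos : 0 < w := Real.sqrt_pos.2 (by linarith)
  have wsq : w ^ 2 = 1 - t := Real.sq_sqrt (by linarith)
  have w1 : w ≤ 1 := by nlinarith
  have l := Real.log_le_sub_one_of_pos wpos
  rw [← wsq, Real.log_pow]
  have ht : t = 1 - w ^ 2 := by linarith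
  rw [ht]
  push_cast
  have : (1 - w ^ 2) ^ 2 / 4 ≤ (1 - w) ^ 2 := by
    have e : (1 - w ^ 2) ^ 2 = (1 - w) ^ 2 * (1 + w) ^ 2 := by ring
    rw [e]
    nlinarith [mul_nonneg (sq_nonneg (1 - w)) (show 0 ≤ 4 - (1 + w) ^ 2 by nlinarith)]
  nlinarith

lemma sum_cross (n : ℕ) : ∑ k ∈ Finset.range (n+1), u (k+1) * u k ≤
    (∑ k ∈ Finset.range n, u (k+1) ^ 2) + u 0 ^ 2 / 2 + u (n+1) ^ 2 / 2 := by
  induction n with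
  | zero => simp; nlinarith [sq_nonneg (u 1 - u 0)]
  | succ n ih =>
    rw [Finset.sum_range_succ, Finset.sum_range_succ (fun k => u (k+1) ^ 2)]
    nlinarith [sq_nonneg (u (n+1+1) - u (n+1))]

lemma log_cc (hu : ∀ k, u (k+1) ∈ Ioo (-1 : ℝ) 1) (n : ℕ) :
    Real.log (cc u n) = ∑ k ∈ Finset.range n, Real.log (1 - u (k+1) ^ 2) :=
  Real.log_prod fun k _ => (one_sub_sq_pos u hu k).ne'

lemma SS_lower (hu : ∀ k, u (k+1) ∈ Ioo (-1 : ℝ) 1) (h0 : u 0 = -1) (n : ℕ) :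
    - Real.log 2 + ∑ k ∈ Finset.range n, (u (k+1) ^ 2) ^ 2 / 4 ≤ ∑ k ∈ Finset.range (n+1), TT u k := by
  have k1 := KK_eq u hu h0 n
  have a1 := u_lt u hu h0 n
  have a3 : 0 < 1 + u (n+1) := by linarith [(hu n).1]
  have l3 := Real.log_le_sub_one_of_pos a3
  have sc := sum_cross u n
  have q : ∑ k ∈ Finset.range n, (u (k+1) ^ 2) ^ 2 / 4 ≤
      ∑ k ∈ Finset.range n, (- Real.log (1 - u (k+1) ^ 2) - u (k+1) ^ 2) :=
    Finset.sum_le_sum fun k _ => log_quad _ (sq_nonneg _) (by linarith [one_sub_sq_pos u hu k])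
  rw [Finset.sum_sub_distrib, Finset.sum_neg_distrib, ← log_cc u hu] at q
  have o := one_sub_sq_pos u hu n
  rw [Finset.sum_range_succ, TT, Real.log_mul a1.ne' a3.ne']
  rw [KK] at k1
  rw [Finset.sum_range_succ, h0] at sc
  nlinarith

lemma conv_of_bdd (hu : ∀ k, u (k+1) ∈ Ioo (-1 : ℝ) 1) (h0 : u 0 = -1) (hs : Summable (TT u)) :
    Tendsto u atTop (𝓝 0) ∧ Tendsto (KK u) atTop (𝓝 (∑' k, TT u k)) := by
  have nn := TT_nonneg u hu h0
  have s4 : Summable fun k => (u (k+1) ^ 2) ^ 2 / 4 := by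
    refine summable_of_sum_range_le (c := ∑' k, TT u k + Real.log 2) (fun k => by positivity) fun n => ?_
    have h1 := SS_lower u hu h0 n
    have h2 := hs.sum_le_tsum (Finset.range (n+1)) fun k _ => nn k
    linarith
  have ut : Tendsto u atTop (𝓝 0) := by
    rw [← tendsto_add_atTop_iff_nat 1]
    have t := s4.tendsto_atTop_zero
    have t2 : Tendsto (fun k => Real.sqrt (Real.sqrt (4 * ((u (k+1) ^ 2) ^ 2 / 4)))) atTop (𝓝 0) := by
      have := (Real.continuous_sqrt.comp Real.continuous_sqrt).tendsto 0 |>.comp (t.const_mul 4 |> fun h => by simpa using h)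
      simpa [Function.comp_def] using this
    refine (tendsto_zero_iff_abs_tendsto_zero _).2 (t2.congr fun k => ?_)
    rw [mul_div_cancel₀ _ (by norm_num : (4:ℝ) ≠ 0), Real.sqrt_sq (sq_nonneg _), Real.sqrt_sq_eq_abs]
    rfl
  refine ⟨ut, ?_⟩
  have e : KK u = fun n => (∑ k ∈ Finset.range n, TT u k) - u n - Real.log (1 - u n) :=
    funext (KK_eq u hu h0)
  rw [e]
  have l : Tendsto (fun n => Real.log (1 - u n)) atTop (𝓝 0) := by
    have h1 : Tendsto (fun n => 1 - u n) atTop (𝓝 1) := by simpa using ut.const_sub 1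
    simpa using h1.log one_ne_zero
  simpa using (hs.hasSum.tendsto_sum_nat.sub ut).sub l

end sums


/-- New sum rule relative to the shifted hard-edge Marchenko–Pastur law `𝒟(2,-2)`. -/
theorem hard_edge_mp_sum_rule (μ : Measure ℝ) [IsProbabilityMeasure μ]
    (hsupp : μ (Icc (-2) 2)ᶜ = 0) (hnt : InfiniteSupport μ)
    (u : ℕ → ℝ) (hu : IsCanonicalMoments μ u) :
    KLdiv Dhard μ = ∑' k : ℕ, ENNReal.ofReal
      ((1 - u k) * (1 + u (k+1)) - Real.log ((1 - u k) * (1 + u (k+1))) - 1) := by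
  have ⟨h0, hu', _⟩ := hu
  rw [KLdiv_eq]
  change _ = ∑' k : ℕ, ENNReal.ofReal (TT u k)
  have nn := TT_nonneg u hu' h0
  have fin : Summable (TT u) → InformationTheory.klDiv Dhard μ ≤ ENNReal.ofReal (∑' k, TT u k) :=
    fun hs => upper_fin μ u hsupp hu _ (conv_of_bdd u hu' h0 hs).2
  by_cases hk : InformationTheory.klDiv Dhard μ = ⊤
  · rw [hk]
    by_contra hne
    have hs : Summable (TT u) := by
      have := ENNReal.summable_toReal (Ne.symm hne)
      refine this.congr fun k => ?_
      rw [ENNReal.toReal_ofReal (nn k)]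
    have := fin hs
    rw [hk, top_le_iff] at this
    exact ENNReal.ofReal_ne_top this
  · have lb := lower_bd μ u hsupp hu hk
    set C := (InformationTheory.klDiv Dhard μ).toReal with hC
    have hs : Summable (TT u) := by
      refine summable_of_sum_range_le (c := C + 1) nn fun n => ?_
      have h1 := SS_le_KK u hu' h0 n
      have h2 := lb n
      have h3 : u (n+1) * u n ≤ 1 := by
        have a1 := hu' n
        have a2 : |u n| ≤ 1 := by
          cases n with
          | zero => rw [h0]; norm_num
          | succ n => exact (abs_lt.2 (hu' n)).le
        have a3 : |u (n+1)| ≤ 1 := (abs_lt.2 a1).le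
        calc u (n+1) * u n ≤ |u (n+1) * u n| := le_abs_self _
          _ = |u (n+1)| * |u n| := abs_mul _ _
          _ ≤ 1 := mul_le_one₀ a3 (abs_nonneg _) a2
      linarith
    obtain ⟨ut, kt⟩ := conv_of_bdd u hu' h0 hs
    have le : ∑' k, TT u k ≤ C := by
      have r : Tendsto (fun n => C + u (n+1) * u n) atTop (𝓝 C) := by
        simpa using (((tendsto_add_atTop_iff_nat 1).2 ut).mul ut).const_add C
      exact le_of_tendsto_of_tendsto' kt r lb
    rw [← ENNReal.ofReal_tsum_of_nonneg nn hs]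
    refine le_antisymm (fin hs) ?_
    rw [← ENNReal.ofReal_toReal hk]
    exact ENNReal.ofReal_le_ofReal le

end SumRules
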